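/- Let k be a field, Γ a finite simple graph on {1,…,n} with clique complex K, d ≥ 0, and suppose the Cartan complex (k⟨K⟩ ⊗_k S, ω) of K has vanishing cohomology H^p = 0 for all p ≠ d+1 (this holds if and only if K is Cohen–Macaulay of dimension d); set F_K = H^{d+1}(k⟨K⟩ ⊗_k S, ω), an S-module. Let f : [n] → [m] be a surjective function and regard k[ℤ^m] = k[y_1^{±1},…,y_m^{±1}] as an S-module via t_i ↦ y_{f(i)} − 1. Then for every q ≥ 0 there is an isomorphism H^q(G_Γ; k[ℤ^m]) ≅ Tor^S_{d+1−q}(F_K, k[ℤ^m]), where the left side is group cohomology of G_Γ with coefficients in k[ℤ^m] with v_i acting as multiplication by y_{f(i)}. -/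

import Mathlib

attribute [local instance] Classical.propDecidable

noncomputable section

open CategoryTheory

/-! ### Right-angled Artin groups -/

/-- The defining relators of a right-angled Artin group. -/
def raagRels {n : ℕ} (G : SimpleGraph (Fin n)) : Set (FreeGroup (Fin n)) :=
  {r | ∃ i j : Fin n, G.Adj i j ∧
    r = FreeGroup.of i * FreeGroup.of j * (FreeGroup.of i)⁻¹ * (FreeGroup.of j)⁻¹}

/-- The right-angled Artin group of a finite simple graph on `Fin n`. -/
abbrev RAAG {n : ℕ} (G : SimpleGraph (Fin n)) : Type :=
  PresentedGroup (raagRels G)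

/-- The clique complex of a graph. -/
def cliqueComplex {n : ℕ} (Γ : SimpleGraph (Fin n)) : Set (Finset (Fin n)) :=
  {σ | ∀ i ∈ σ, ∀ j ∈ σ, i ≠ j → Γ.Adj i j}

/-! ### Group cohomology with coefficients in `k[ℤᵐ]` -/

/-- The group algebra `k[ℤᵐ]` of Laurent polynomials. -/
abbrev LaurentRing (k : Type) [CommRing k] (m : ℕ) : Type :=
  AddMonoidAlgebra k (Fin m → ℤ)

/-- Multiplication by the monomial `y^v` on the Laurent ring. -/
def yMul (k : Type) [CommRing k] (m : ℕ) (v : Fin m → ℤ) :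
    LaurentRing k m →ₗ[LaurentRing k m] LaurentRing k m :=
  LinearMap.mulLeft (LaurentRing k m) (AddMonoidAlgebra.single v 1)

/-- The space of inhomogeneous `q`-cochains of `G` with values in `k[ℤᵐ]`. -/
abbrev inhomogCochains (k : Type) [CommRing k] (m : ℕ) (G : Type) (q : ℕ) : Type :=
  (Fin q → G) → LaurentRing k m

variable (k : Type) [Field k] {m : ℕ} {G : Type} [Group G]
  (φ : G →* Multiplicative (Fin m → ℤ))

/-- The differential of the inhomogeneous cochain complex computing group
cohomology, where `g ∈ G` acts on `k[ℤᵐ]` by multiplication by `y^{φ g}`. -/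
def inhomogCoD (q : ℕ) :
    inhomogCochains k m G q →ₗ[LaurentRing k m] inhomogCochains k m G (q + 1) :=
  LinearMap.pi fun g : Fin (q + 1) → G =>
    (yMul k m (Multiplicative.toAdd (φ (g 0)))).comp
        (LinearMap.proj (fun i => g i.succ)) +
    ∑ j : Fin (q + 1),
      ((-1 : ℤ) ^ ((j : ℕ) + 1)) • LinearMap.proj (Fin.contractNth j (· * ·) g)

/-- The cochain differential entering degree `q` (zero for `q = 0`). -/
def inhomogCoDpre : ∀ q : ℕ,
    inhomogCochains k m G (q - 1) →ₗ[LaurentRing k m] inhomogCochains k m G q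
  | 0 => 0
  | (q + 1) => inhomogCoD k φ q

/-- The group cohomology `H^q(G; k[ℤᵐ])`. -/
def groupCohomologyLaurent (q : ℕ) : Type :=
  ↥(Submodule.map (LinearMap.range (inhomogCoDpre k φ q)).mkQ
      (LinearMap.ker (inhomogCoD k φ q)))

instance (q : ℕ) : AddCommGroup (groupCohomologyLaurent k φ q) :=
  inferInstanceAs (AddCommGroup ↥(Submodule.map _ _))

instance (q : ℕ) : Module (LaurentRing k m) (groupCohomologyLaurent k φ q) :=
  inferInstanceAs (Module _ ↥(Submodule.map _ _))

/-! ### The polynomial ring `S` and the Cartan complex -/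

/-- The polynomial ring `S = k[t₁,…,tₙ]`. -/
abbrev polyRing (k : Type) [Field k] (n : ℕ) : Type := MvPolynomial (Fin n) k

/-- The ring homomorphism `S → k[ℤᵐ]`, `tᵢ ↦ y_{f i} - 1`. -/
def phiS (k : Type) [Field k] {n m : ℕ} (f : Fin n → Fin m) :
    polyRing k n →+* LaurentRing k m :=
  (MvPolynomial.eval₂Hom (algebraMap k (LaurentRing k m))
    (fun i => AddMonoidAlgebra.single (Pi.single (f i) 1) 1 - 1))

variable {n : ℕ} (K : Set (Finset (Fin n)))

/-- The degree-`p` term `k⟨K⟩_p ⊗_k S` of the Cartan complex. -/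
abbrev cartanTerm (p : ℕ) : Type :=
  {I : Finset (Fin n) // I ∈ K ∧ I.card = p} → polyRing k n

/-- The Cartan differential, left multiplication by `ω = ∑ eᵢ ⊗ tᵢ`. -/
def cartanD (p : ℕ) : cartanTerm k K p →ₗ[polyRing k n] cartanTerm k K (p + 1) :=
  LinearMap.pi fun J => ∑ i : Fin n,
    if h : i ∈ J.1 ∧ J.1.erase i ∈ K then
      ((-1 : ℤ) ^ (J.1.filter (· < i)).card) •
        ((LinearMap.mulLeft (polyRing k n) (MvPolynomial.X i)).comp
          (LinearMap.proj
            (⟨J.1.erase i, h.2, by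
                rw [Finset.card_erase_of_mem h.1, J.2.2, Nat.add_sub_cancel]⟩ :
              {I : Finset (Fin n) // I ∈ K ∧ I.card = p})))
    else 0

/-- The Cartan differential entering degree `p` (zero for `p = 0`). -/
def cartanDpre : ∀ p : ℕ, cartanTerm k K (p - 1) →ₗ[polyRing k n] cartanTerm k K p
  | 0 => 0
  | (p + 1) => cartanD k K p

/-- The `p`-th cohomology of the Cartan complex `(k⟨K⟩ ⊗_k S, ω)`. -/
def cartanCohomology (p : ℕ) : Type :=
  ↥(Submodule.map (LinearMap.range (cartanDpre k K p)).mkQ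
      (LinearMap.ker (cartanD k K p)))

instance (p : ℕ) : AddCommGroup (cartanCohomology k K p) :=
  inferInstanceAs (AddCommGroup ↥(Submodule.map _ _))

instance (p : ℕ) : Module (polyRing k n) (cartanCohomology k K p) :=
  inferInstanceAs (Module _ ↥(Submodule.map _ _))

/-- Group cohomology `H^q(G; k[ℤᵐ])`, regarded as an `S`-module via
`tᵢ ↦ y_{f i} - 1`. -/
def groupCohomologyS {n : ℕ} (f : Fin n → Fin m) (q : ℕ) : Type :=
  groupCohomologyLaurent k φ q

instance {n : ℕ} (f : Fin n → Fin m) (q : ℕ) :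
    AddCommGroup (groupCohomologyS k φ f q) :=
  inferInstanceAs (AddCommGroup (groupCohomologyLaurent k φ q))

instance {n : ℕ} (f : Fin n → Fin m) (q : ℕ) :
    Module (polyRing k n) (groupCohomologyS k φ f q) :=
  Module.compHom (groupCohomologyLaurent k φ q) (phiS k f)

/-- The `S`-module `k[ℤᵐ]` (restriction of scalars along `tᵢ ↦ y_{f i} - 1`). -/
def laurentAsSModule (k : Type) [Field k] {n m : ℕ} (f : Fin n → Fin m) :
    ModuleCat (polyRing k n) :=
  (ModuleCat.restrictScalars (phiS k f)).obj
    (ModuleCat.of (LaurentRing k m) (LaurentRing k m))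

/-! ### Integrating cocycles on a right-angled Artin group -/

theorem RAAG.of_mul_of {n : ℕ} {Γ : SimpleGraph (Fin n)} {i j : Fin n} (h : Γ.Adj i j) :
    (PresentedGroup.of i * PresentedGroup.of j : RAAG Γ) =
      PresentedGroup.of j * PresentedGroup.of i := by
  have := PresentedGroup.one_of_mem (rels := raagRels Γ) ⟨i, j, h, rfl⟩
  simp only [map_mul, map_inv] at this
  rwa [mul_inv_eq_one, mul_inv_eq_iff_eq_mul] at this

/-- A function on the edges (labelled by `W`) of the Cayley graph of a right-angled Artin group
which is closed on every commutation square has a primitive. -/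
theorem RAAG.exists_primitive {n : ℕ} (Γ : SimpleGraph (Fin n)) {N : Type*} [AddCommGroup N]
    (W : Finset (Fin n)) (b : Fin n → RAAG Γ → N)
    (hb : ∀ i ∈ W, ∀ j ∈ W, Γ.Adj i j → ∀ x : RAAG Γ,
      b i (x * PresentedGroup.of j) + b j x = b j (x * PresentedGroup.of i) + b i x) :
    ∃ u : RAAG Γ → N, ∀ i ∈ W, ∀ x, u (x * PresentedGroup.of i) = u x + b i x := by
  let v : Fin n → RAAG Γ := PresentedGroup.of
  have hv : ∀ i j, Γ.Adj i j → v i * v j = v j * v i := fun i j h => RAAG.of_mul_of h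
  let Q : Fin n → Equiv.Perm (RAAG Γ × N) := fun i =>
    if i ∈ W then
      { toFun := fun z => (z.1 * v i, z.2 + b i z.1)
        invFun := fun z => (z.1 * (v i)⁻¹, z.2 - b i (z.1 * (v i)⁻¹))
        left_inv := fun z => by simp
        right_inv := fun z => by simp }
    else 1
  have hQ : ∀ i ∈ W, ∀ z, Q i z = (z.1 * v i, z.2 + b i z.1) := fun i hi z => by simp [Q, hi]
  have hQ' : ∀ i ∉ W, Q i = 1 := fun i hi => by simp [Q, hi]
  have hQc : ∀ i j, Γ.Adj i j → Q i * Q j = Q j * Q i := fun i j h => by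
    by_cases hi : i ∈ W
    · by_cases hj : j ∈ W
      · ext1 z
        rw [Equiv.Perm.mul_apply, Equiv.Perm.mul_apply, hQ i hi, hQ j hj, hQ j hj, hQ i hi]
        refine Prod.ext ?_ ?_
        · simp only [mul_assoc, hv i j h]
        · have := hb i hi j hj h z.1
          simp only [add_assoc, v]
          rw [add_comm (b j z.1), this, add_comm (b i z.1)]
      · simp [hQ' j hj]
    · simp [hQ' i hi]
  have hrelQ : ∀ r ∈ raagRels Γ, FreeGroup.lift (fun i => MulOpposite.op (Q i)) r = 1 := by
    rintro r ⟨i, j, h, rfl⟩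
    simp only [map_mul, map_inv, FreeGroup.lift_apply_of]
    rw [mul_inv_eq_one, mul_inv_eq_iff_eq_mul, ← MulOpposite.op_mul, ← MulOpposite.op_mul,
      hQc i j h]
  have hrelv : ∀ r ∈ raagRels Γ, FreeGroup.lift (fun i => if i ∈ W then v i else 1) r = 1 := by
    rintro r ⟨i, j, h, rfl⟩
    simp only [map_mul, map_inv, FreeGroup.lift_apply_of]
    rw [mul_inv_eq_one, mul_inv_eq_iff_eq_mul]
    split_ifs <;> simp [hv i j h]
  let Φ : RAAG Γ →* (Equiv.Perm (RAAG Γ × N))ᵐᵒᵖ := PresentedGroup.toGroup hrelQ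
  let ρ : RAAG Γ →* RAAG Γ := PresentedGroup.toGroup hrelv
  have hΦ : ∀ i, Φ (v i) = MulOpposite.op (Q i) := fun i => PresentedGroup.toGroup.of hrelQ
  have hρ : ∀ i, ρ (v i) = if i ∈ W then v i else 1 := fun i => PresentedGroup.toGroup.of hrelv
  let H : Subgroup (RAAG Γ) :=
    { carrier := {g | ∀ z, ((Φ g).unop z).1 = z.1 * ρ g}
      one_mem' := fun z => by simp
      mul_mem' := fun {g h} hg hh z => by
        simp only [Set.mem_ofPred_eq] at hg hh
        simp only [map_mul, MulOpposite.unop_mul, Equiv.Perm.mul_apply]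
        rw [hh, hg, mul_assoc]
      inv_mem' := fun {g} hg z => by
        simp only [Set.mem_ofPred_eq] at hg
        have := hg ((Φ g⁻¹).unop z)
        have e : (Φ g).unop ((Φ g⁻¹).unop z) = z := by
          rw [map_inv, MulOpposite.unop_inv]
          exact Equiv.apply_symm_apply _ _
        rw [e] at this
        rw [map_inv ρ]
        exact eq_mul_inv_of_mul_eq this.symm }
  have hH : ∀ g, g ∈ H := fun g => PresentedGroup.generated_by _ H (fun i z => by
    change ((Φ (v i)).unop z).1 = z.1 * ρ (v i)
    rw [hΦ, hρ, MulOpposite.unop_op]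
    by_cases hi : i ∈ W
    · rw [hQ i hi, if_pos hi]
    · simp [hQ' i hi, hi]) g
  refine ⟨fun x => ((Φ x).unop (x * (ρ x)⁻¹, 0)).2, fun i hi x => ?_⟩
  change ((Φ (x * v i)).unop (x * v i * (ρ (x * v i))⁻¹, 0)).2 = _
  rw [map_mul, map_mul, hΦ, hρ, if_pos hi, MulOpposite.unop_mul, MulOpposite.unop_op,
    Equiv.Perm.mul_apply, hQ i hi, mul_inv_rev, mul_assoc, mul_inv_cancel_left, hH x]
  simp

/-! ### Koszul-type complexes on a simplicial complex -/

/-- The Koszul differential `c ↦ (∑ eᵢ ⊗ Tᵢ) c` on functions on all finite subsets. -/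
def koszulTotal {R M : Type*} [CommRing R] [AddCommGroup M] [Module R M] {n : ℕ}
    (T : Fin n → M →ₗ[R] M) (c : Finset (Fin n) → M) (J : Finset (Fin n)) : M :=
  ∑ i ∈ J, ((-1 : ℤ) ^ (J.filter (· < i)).card) • T i (c (J.erase i))

/-- The Koszul differential on functions on the faces of `K`. -/
def koszulD {R M : Type*} [CommRing R] [AddCommGroup M] [Module R M] {n : ℕ}
    (K : Set (Finset (Fin n))) (T : Fin n → M →ₗ[R] M) (p : ℕ) :
    ({I : Finset (Fin n) // I ∈ K ∧ I.card = p} → M) →ₗ[R]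
      ({I : Finset (Fin n) // I ∈ K ∧ I.card = p + 1} → M) :=
  LinearMap.pi fun J => ∑ i : Fin n,
    if h : i ∈ J.1 ∧ J.1.erase i ∈ K then
      ((-1 : ℤ) ^ (J.1.filter (· < i)).card) •
        ((T i).comp
          (LinearMap.proj
            (⟨J.1.erase i, h.2, by
                rw [Finset.card_erase_of_mem h.1, J.2.2, Nat.add_sub_cancel]⟩ :
              {I : Finset (Fin n) // I ∈ K ∧ I.card = p})))
    else 0

/-- The Koszul differential entering degree `p` (zero for `p = 0`). -/
def koszulDpre {R M : Type*} [CommRing R] [AddCommGroup M] [Module R M] {n : ℕ}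
    (K : Set (Finset (Fin n))) (T : Fin n → M →ₗ[R] M) : ∀ p : ℕ,
    ({I : Finset (Fin n) // I ∈ K ∧ I.card = p - 1} → M) →ₗ[R]
      ({I : Finset (Fin n) // I ∈ K ∧ I.card = p} → M)
  | 0 => 0
  | (p + 1) => koszulD K T p

/-- Extension by zero of a function on the `p`-element faces of `K`. -/
def extendFaces {M : Type*} [AddCommGroup M] {n : ℕ} {K : Set (Finset (Fin n))} {p : ℕ}
    (c : {I : Finset (Fin n) // I ∈ K ∧ I.card = p} → M) (I : Finset (Fin n)) : M :=
  if h : I ∈ K ∧ I.card = p then c ⟨I, h⟩ else 0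

section Koszul

variable {R M M' : Type*} [CommRing R] [AddCommGroup M] [Module R M] [AddCommGroup M']
  [Module R M'] {n : ℕ} {K : Set (Finset (Fin n))}

theorem koszulD_apply (T : Fin n → M →ₗ[R] M) (p : ℕ)
    (c : {I : Finset (Fin n) // I ∈ K ∧ I.card = p} → M)
    (J : {I : Finset (Fin n) // I ∈ K ∧ I.card = p + 1}) :
    koszulD K T p c J = koszulTotal T (extendFaces c) J.1 := by
  rw [koszulTotal, koszulD, LinearMap.pi_apply, LinearMap.sum_apply,
    ← Finset.sum_subset (Finset.subset_univ J.1)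
      (fun i _ hi => by rw [dif_neg (fun h => hi h.1)]; rfl)]
  refine Finset.sum_congr rfl fun i hi => ?_
  have hc : (J.1.erase i).card = p := by
    rw [Finset.card_erase_of_mem hi, J.2.2, Nat.add_sub_cancel]
  by_cases h : J.1.erase i ∈ K
  · rw [dif_pos ⟨hi, h⟩, extendFaces, dif_pos ⟨h, hc⟩]
    rfl
  · rw [dif_neg (fun h' => h h'.2), extendFaces, dif_neg (fun h' => h h'.1)]
    simp

theorem koszulTotal_koszulTotal (T : Fin n → M →ₗ[R] M) (c : Finset (Fin n) → M)
    (J : Finset (Fin n))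
    (hT : ∀ i ∈ J, ∀ j ∈ J, i ≠ j → ∀ x, T i (T j x) = T j (T i x)) :
    koszulTotal T (koszulTotal T c) J = 0 := by
  have hsign : ∀ i ∈ J, ∀ j ∈ J, i < j →
      ((-1 : ℤ) ^ (J.filter (· < i)).card) *
          (-1 : ℤ) ^ ((J.erase i).filter (· < j)).card =
        -(((-1 : ℤ) ^ (J.filter (· < j)).card) *
          (-1 : ℤ) ^ ((J.erase j).filter (· < i)).card) := by
    intro i hi j hj hij
    have h1 : (J.erase j).filter (· < i) = J.filter (· < i) := by
      rw [Finset.filter_erase, Finset.erase_eq_of_notMem]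
      simp [hij.le]
    have h2 : (J.filter (· < j)).card = ((J.erase i).filter (· < j)).card + 1 := by
      rw [Finset.filter_erase, Finset.card_erase_add_one]
      simp [hi, hij]
    rw [h1, h2, pow_succ]
    ring
  simp only [koszulTotal, map_sum, map_zsmul, Finset.smul_sum, smul_smul]
  rw [Finset.sum_sigma']
  refine Finset.sum_involution (fun z _ => ⟨z.2, z.1⟩) ?_ ?_ ?_ ?_
  · rintro ⟨i, j⟩ hz
    simp only [Finset.mem_sigma, Finset.mem_erase] at hz
    obtain ⟨hi, hji, hj⟩ := hz
    simp only [Finset.erase_right_comm (a := j), hT j hj i hi hji]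
    rw [← add_smul]
    rcases lt_or_gt_of_ne hji with h | h
    · rw [hsign j hj i hi h, add_neg_cancel, zero_smul]
    · rw [hsign i hi j hj h, neg_add_cancel, zero_smul]
  · rintro ⟨i, j⟩ hz _ h
    simp only [Finset.mem_sigma, Finset.mem_erase] at hz
    exact hz.2.1 (congrArg Sigma.fst h)
  · rintro ⟨i, j⟩ hz
    simp only [Finset.mem_sigma, Finset.mem_erase] at hz ⊢
    exact ⟨hz.2.2, hz.2.1.symm, hz.1⟩
  · intros; rfl

theorem koszulTotal_congr (T : Fin n → M →ₗ[R] M) {c c' : Finset (Fin n) → M}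
    {J : Finset (Fin n)} (h : ∀ i ∈ J, c (J.erase i) = c' (J.erase i)) :
    koszulTotal T c J = koszulTotal T c' J :=
  Finset.sum_congr rfl fun i hi => by rw [h i hi]

theorem koszulTotal_add (T : Fin n → M →ₗ[R] M) (c c' : Finset (Fin n) → M)
    (J : Finset (Fin n)) :
    koszulTotal T (c + c') J = koszulTotal T c J + koszulTotal T c' J := by
  simp [koszulTotal, Finset.sum_add_distrib]

theorem koszulTotal_sub (T : Fin n → M →ₗ[R] M) (c c' : Finset (Fin n) → M)
    (J : Finset (Fin n)) :
    koszulTotal T (c - c') J = koszulTotal T c J - koszulTotal T c' J := by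
  simp [koszulTotal, Finset.sum_sub_distrib, smul_sub]

/-- The Koszul differential is natural in the module of coefficients. -/
theorem koszulD_comp (T : Fin n → M →ₗ[R] M) (T' : Fin n → M' →ₗ[R] M') (g : M →ₗ[R] M')
    (hg : ∀ i x, g (T i x) = T' i (g x)) (p : ℕ)
    (c : {I : Finset (Fin n) // I ∈ K ∧ I.card = p} → M) :
    koszulD K T' p (g.compLeft _ c) = g.compLeft _ (koszulD K T p c) := by
  ext J
  have : extendFaces (g.compLeft _ c) = fun I => g (extendFaces c I) := by
    ext I
    unfold extendFaces
    split_ifs <;> simp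
  simp [koszulD_apply, koszulTotal, this, hg]

end Koszul

/-! ### Acyclicity of coinduced coefficients -/

/-- The operator `u ↦ u(· a) - u` on functions on a group. -/
def transSub (R : Type*) {N : Type*} [CommRing R] [AddCommGroup N] [Module R N]
    {G : Type*} [Group G] (a : G) : (G → N) →ₗ[R] (G → N) :=
  LinearMap.funLeft R N (fun x => x * a) - LinearMap.id

theorem transSub_apply {R N : Type*} [CommRing R] [AddCommGroup N] [Module R N]
    {G : Type*} [Group G] (a : G) (u : G → N) (x : G) :
    transSub R a u x = u (x * a) - u x := rfl

theorem transSub_comm {R N : Type*} [CommRing R] [AddCommGroup N] [Module R N]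
    {n : ℕ} {Γ : SimpleGraph (Fin n)} {i j : Fin n} (h : Γ.Adj i j) (u : RAAG Γ → N) :
    transSub R (PresentedGroup.of i : RAAG Γ) (transSub R (PresentedGroup.of j : RAAG Γ) u) =
      transSub R (PresentedGroup.of j : RAAG Γ) (transSub R (PresentedGroup.of i) u) := by
  ext x
  simp only [transSub_apply, mul_assoc, RAAG.of_mul_of h]
  abel

theorem koszulTotal_singleton {R M : Type*} [CommRing R] [AddCommGroup M] [Module R M] {n : ℕ}
    (T : Fin n → M →ₗ[R] M) (c : Finset (Fin n) → M) (i : Fin n) :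
    koszulTotal T c {i} = T i (c ∅) := by
  simp [koszulTotal, Finset.filter_singleton]

theorem koszulTotal_pair {R M : Type*} [CommRing R] [AddCommGroup M] [Module R M] {n : ℕ}
    (T : Fin n → M →ₗ[R] M) (c : Finset (Fin n) → M) {i j : Fin n} (h : i < j) :
    koszulTotal T c {i, j} = T i (c {j}) - T j (c {i}) := by
  have h1 : ({i, j} : Finset (Fin n)).erase i = {j} := by
    rw [Finset.erase_insert]; simpa using h.ne
  have h2 : ({i, j} : Finset (Fin n)).erase j = {i} := by
    rw [Finset.pair_comm, Finset.erase_insert]; simpa using h.ne'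
  rw [koszulTotal, Finset.sum_pair h.ne, h1, h2]
  simp [Finset.filter_insert, Finset.filter_singleton, h, h.not_gt, sub_eq_add_neg]

/-- Splitting off a largest vertex in the Koszul differential. -/
theorem koszulTotal_insert {R M : Type*} [CommRing R] [AddCommGroup M] [Module R M] {n : ℕ}
    (T : Fin n → M →ₗ[R] M) (c : Finset (Fin n) → M) {v : Fin n} {J : Finset (Fin n)}
    (h : ∀ i ∈ J, i < v) :
    koszulTotal T c (insert v J) =
      ((-1 : ℤ) ^ J.card) • T v (c J) + koszulTotal T (fun I => c (insert v I)) J := by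
  have hv : v ∉ J := fun hv => (h v hv).false
  rw [koszulTotal, Finset.sum_insert hv, Finset.erase_insert hv, koszulTotal]
  congr 1
  · rw [Finset.filter_insert, if_neg (lt_irrefl v), Finset.filter_true_of_mem h]
  · refine Finset.sum_congr rfl fun i hi => ?_
    rw [Finset.filter_insert, if_neg (h i hi).not_gt,
      Finset.erase_insert_of_ne (h i hi).ne']

theorem cliqueComplex_mono {n : ℕ} {Γ : SimpleGraph (Fin n)} {I J : Finset (Fin n)}
    (hJ : J ∈ cliqueComplex Γ) (h : I ⊆ J) : I ∈ cliqueComplex Γ :=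
  fun i hi j hj hij => hJ i (h hi) j (h hj) hij

theorem insert_mem_cliqueComplex {n : ℕ} {Γ : SimpleGraph (Fin n)} {J : Finset (Fin n)}
    {v : Fin n} (hJ : J ∈ cliqueComplex Γ) (h : ∀ i ∈ J, Γ.Adj v i) :
    insert v J ∈ cliqueComplex Γ := by
  intro i hi j hj hij
  rcases Finset.mem_insert.1 hi with rfl | hi'
  · rcases Finset.mem_insert.1 hj with rfl | hj'
    · exact absurd rfl hij
    · exact h j hj'
  · rcases Finset.mem_insert.1 hj with rfl | hj'
    · exact (h i hi').symm
    · exact hJ i hi' j hj' hij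

/-- The Koszul differential squares to zero when adjacent operators commute. -/
theorem koszulD_koszulD {R M : Type*} [CommRing R] [AddCommGroup M] [Module R M] {n : ℕ}
    {Γ : SimpleGraph (Fin n)} (T : Fin n → M →ₗ[R] M)
    (hT : ∀ i j, Γ.Adj i j → ∀ x, T i (T j x) = T j (T i x)) (p : ℕ)
    (c : {I : Finset (Fin n) // I ∈ cliqueComplex Γ ∧ I.card = p} → M) :
    koszulD (cliqueComplex Γ) T (p + 1) (koszulD (cliqueComplex Γ) T p c) = 0 := by
  ext J
  rw [koszulD_apply, Pi.zero_apply, ← koszulTotal_koszulTotal T (extendFaces c) J.1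
    fun i hi j hj hij => hT i j (J.2.1 i hi j hj hij)]
  refine koszulTotal_congr _ fun i hi => ?_
  have h : J.1.erase i ∈ cliqueComplex Γ ∧ (J.1.erase i).card = p + 1 :=
    ⟨cliqueComplex_mono J.2.1 (Finset.erase_subset _ _), by
      rw [Finset.card_erase_of_mem hi, J.2.2, Nat.add_sub_cancel]⟩
  rw [extendFaces, dif_pos h, koszulD_apply]

/-- The Koszul complex of a clique complex with coefficients in functions on the right-angled
Artin group is exact in positive degrees, also after restriction to a set `W` of vertices. -/
theorem koszulTotal_transSub_exact {R N : Type*} [CommRing R] [AddCommGroup N] [Module R N]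
    {n : ℕ} (Γ : SimpleGraph (Fin n)) (W : Finset (Fin n)) (p : ℕ)
    (c : Finset (Fin n) → RAAG Γ → N)
    (hc : ∀ J ∈ cliqueComplex Γ, J ⊆ W → J.card = p + 2 →
      koszulTotal (fun i => transSub R (PresentedGroup.of i : RAAG Γ)) c J = 0) :
    ∃ b : Finset (Fin n) → RAAG Γ → N, ∀ J ∈ cliqueComplex Γ, J ⊆ W → J.card = p + 1 →
      koszulTotal (fun i => transSub R (PresentedGroup.of i : RAAG Γ)) b J = c J := by
  induction W using Finset.strongInduction generalizing p c with
  | H W ih =>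
  set T : Fin n → (RAAG Γ → N) →ₗ[R] (RAAG Γ → N) :=
    fun i => transSub R (PresentedGroup.of i : RAAG Γ) with hT
  cases p with
  | zero =>
    have hlt : ∀ i ∈ W, ∀ j ∈ W, Γ.Adj i j → i < j → T i (c {j}) = T j (c {i}) := by
      intro i hi j hj hij h
      have := hc {i, j} (insert_mem_cliqueComplex (fun a ha b hb hab => by
          simp only [Finset.mem_singleton] at ha hb
          exact absurd (ha.trans hb.symm) hab) (by simpa using hij))
        (by simp [Finset.insert_subset_iff, hi, hj]) (Finset.card_pair h.ne)
      rw [koszulTotal_pair _ _ h] at this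
      exact sub_eq_zero.1 this
    have hcomm : ∀ i ∈ W, ∀ j ∈ W, Γ.Adj i j → T i (c {j}) = T j (c {i}) := by
      intro i hi j hj hij
      rcases lt_or_gt_of_ne hij.ne with h | h
      · exact hlt i hi j hj hij h
      · exact (hlt j hj i hi hij.symm h).symm
    obtain ⟨u, hu⟩ := RAAG.exists_primitive Γ W (fun i => c {i}) fun i hi j hj hij x => by
      have := congrFun (hcomm i hi j hj hij) x
      simp only [hT, transSub_apply, sub_eq_sub_iff_add_eq_add] at this
      exact this.symm
    refine ⟨fun _ => u, fun J _ hJW hJ => ?_⟩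
    obtain ⟨i, rfl⟩ := Finset.card_eq_one.1 hJ
    rw [koszulTotal_singleton]
    ext x
    simp [hT, transSub_apply, hu i (hJW (Finset.mem_singleton_self i))]
  | succ p =>
    rcases W.eq_empty_or_nonempty with rfl | hne
    · refine ⟨0, fun J _ hJ hcard => ?_⟩
      rw [Finset.subset_empty.1 hJ] at hcard
      simp at hcard
    set v := W.max' hne with hv
    have hvW : v ∈ W := W.max'_mem hne
    have hmax : ∀ i ∈ W.erase v, i < v := fun i hi =>
      lt_of_le_of_ne (W.le_max' i (Finset.mem_of_mem_erase hi)) (Finset.ne_of_mem_erase hi)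
    obtain ⟨b₁, hb₁⟩ := ih (W.erase v) (Finset.erase_ssubset hvW) (p + 1) c
      fun J hJ hJW hcard => hc J hJ (hJW.trans (Finset.erase_subset _ _)) hcard
    let b₀ : Finset (Fin n) → RAAG Γ → N := fun I => if v ∈ I then 0 else b₁ I
    have hb₀ : ∀ J, v ∉ J → koszulTotal T b₀ J = koszulTotal T b₁ J := fun J hJ =>
      koszulTotal_congr T fun i _ => if_neg fun h => hJ (Finset.mem_of_mem_erase h)
    let c' := c - koszulTotal T b₀
    have hc'0 : ∀ J ∈ cliqueComplex Γ, J ⊆ W.erase v → J.card = p + 2 → c' J = 0 := by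
      intro J hJ hJW hcard
      have hvJ : v ∉ J := fun h => (Finset.notMem_erase v W) (hJW h)
      simp only [c', Pi.sub_apply, hb₀ J hvJ, hb₁ J hJ hJW hcard, sub_self]
    have hc' : ∀ J ∈ cliqueComplex Γ, J ⊆ W → J.card = p + 3 → koszulTotal T c' J = 0 := by
      intro J hJ hJW hcard
      rw [koszulTotal_sub, hc J hJ hJW hcard, koszulTotal_koszulTotal, sub_zero]
      exact fun i hi j hj hij x => transSub_comm (hJ i hi j hj hij) x
    let L := (W.erase v).filter (Γ.Adj v)
    have hL : L ⊂ W :=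
      lt_of_le_of_lt (Finset.filter_subset _ _) (Finset.erase_ssubset hvW)
    have hLW : L ⊆ W.erase v := Finset.filter_subset _ _
    obtain ⟨b₂, hb₂⟩ := ih L hL p (fun I => c' (insert v I)) fun J hJ hJL hcard => by
      have hlt : ∀ i ∈ J, i < v := fun i hi => hmax i (hLW (hJL hi))
      have hvJ : v ∉ J := fun h => (hlt v h).false
      have := hc' (insert v J)
        (insert_mem_cliqueComplex hJ fun i hi => (Finset.mem_filter.1 (hJL hi)).2)
        (Finset.insert_subset hvW ((hJL.trans hLW).trans (Finset.erase_subset _ _)))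
        (by rw [Finset.card_insert_of_notMem hvJ, hcard])
      rwa [koszulTotal_insert T _ hlt, hc'0 J hJ (hJL.trans hLW) hcard, map_zero, smul_zero,
        zero_add] at this
    let b₃ : Finset (Fin n) → RAAG Γ → N := fun I => if v ∈ I then b₂ (I.erase v) else 0
    refine ⟨b₀ + b₃, fun J hJ hJW hcard => ?_⟩
    rw [koszulTotal_add]
    suffices h : koszulTotal T b₃ J = c' J by rw [h]; simp [c']
    by_cases hvJ : v ∈ J
    · have hlt : ∀ i ∈ J.erase v, i < v := fun i hi =>
        hmax i (Finset.erase_subset_erase v hJW hi)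
      have hcard' : (J.erase v).card = p + 1 := by
        rw [Finset.card_erase_of_mem hvJ, hcard]; rfl
      have hJL : J.erase v ⊆ L := fun i hi => Finset.mem_filter.2
        ⟨Finset.erase_subset_erase v hJW hi, hJ v hvJ i (Finset.mem_of_mem_erase hi)
          (hlt i hi).ne'⟩
      have h2 := hb₂ (J.erase v) (cliqueComplex_mono hJ (Finset.erase_subset _ _)) hJL hcard'
      rw [Finset.insert_erase hvJ] at h2
      rw [← h2]
      conv_lhs => rw [← Finset.insert_erase hvJ]
      rw [koszulTotal_insert T _ hlt]
      have h3 : b₃ (J.erase v) = 0 := if_neg (Finset.notMem_erase v J)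
      rw [h3, map_zero, smul_zero, zero_add]
      refine koszulTotal_congr T fun i hi => ?_
      have hvi : v ∉ (J.erase v).erase i := fun h =>
        Finset.notMem_erase v J (Finset.mem_of_mem_erase h)
      simp only [b₃, Finset.mem_insert_self, if_true, Finset.erase_insert hvi]
    · have hJW' : J ⊆ W.erase v := Finset.subset_erase.2 ⟨hJW, hvJ⟩
      rw [hc'0 J hJ hJW' hcard]
      refine Finset.sum_eq_zero fun i hi => ?_
      have : b₃ (J.erase i) = 0 := if_neg fun h => hvJ (Finset.mem_of_mem_erase h)
      rw [this, map_zero, smul_zero]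

/-- The Koszul complex with coefficients in functions on the right-angled Artin group is exact
in positive degrees. -/
theorem koszulD_transSub_exact {R N : Type*} [CommRing R] [AddCommGroup N] [Module R N]
    {n : ℕ} (Γ : SimpleGraph (Fin n)) (p : ℕ) :
    Function.Exact
      (koszulD (cliqueComplex Γ) (fun i => transSub (N := N) R (PresentedGroup.of i : RAAG Γ)) p)
      (koszulD (cliqueComplex Γ)
        (fun i => transSub (N := N) R (PresentedGroup.of i : RAAG Γ)) (p + 1)) := by
  intro c
  constructor
  · intro hc
    obtain ⟨b, hb⟩ := koszulTotal_transSub_exact (R := R) Γ Finset.univ p (extendFaces c)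
      fun J hJ _ hcard => by rw [← koszulD_apply _ _ c ⟨J, hJ, hcard⟩, hc]; rfl
    refine ⟨fun I => b I.1, funext fun J => ?_⟩
    have := hb J.1 J.2.1 (Finset.subset_univ _) J.2.2
    rw [extendFaces, dif_pos J.2] at this
    rw [koszulD_apply, ← this]
    refine koszulTotal_congr _ fun i hi => ?_
    rw [extendFaces, dif_pos]
    exact ⟨cliqueComplex_mono J.2.1 (Finset.erase_subset _ _), by
      rw [Finset.card_erase_of_mem hi, J.2.2, Nat.add_sub_cancel]⟩
  · rintro ⟨b, rfl⟩
    exact koszulD_koszulD _ (fun i j h x => transSub_comm h x) p b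

/-! ### Subquotients and diagram chases in double complexes -/

/-- The image of `S` in the quotient by `S'`. -/
abbrev Subquotient {R X : Type*} [Ring R] [AddCommGroup X] [Module R X]
    (S' S : Submodule R X) : Type _ :=
  ↥(S.map S'.mkQ)

section Subquotient

variable {R : Type*} [Ring R] {X Y Z X₀ X₁ Z₀ Z₁ : Type*}
  [AddCommGroup X] [Module R X] [AddCommGroup Y] [Module R Y] [AddCommGroup Z] [Module R Z]
  [AddCommGroup X₀] [Module R X₀] [AddCommGroup X₁] [Module R X₁]
  [AddCommGroup Z₀] [Module R Z₀] [AddCommGroup Z₁] [Module R Z₁]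

theorem Subquotient.nonempty_equiv (f : X →ₗ[R] Y) {S' S : Submodule R X}
    {T' T : Submodule R Y} (hST : ∀ x ∈ S, f x ∈ T) (hTS : ∀ y ∈ T, ∃ x ∈ S, f x - y ∈ T')
    (hker : ∀ x ∈ S, f x ∈ T' ↔ x ∈ S') :
    Nonempty (Subquotient S' S ≃ₗ[R] Subquotient T' T) := by
  let a : S →ₗ[R] Subquotient S' S := S'.mkQ.submoduleMap S
  let b : S →ₗ[R] Subquotient T' T := (T'.mkQ.submoduleMap T).comp (f.restrict hST)
  have ha : Function.Surjective a := LinearMap.submoduleMap_surjective _ _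
  have hb : Function.Surjective b := by
    rintro ⟨_, y, hy, rfl⟩
    obtain ⟨x, hx, h⟩ := hTS y hy
    exact ⟨⟨x, hx⟩, Subtype.ext ((Submodule.Quotient.eq T').2 h)⟩
  have hab : LinearMap.ker a = LinearMap.ker b := by
    ext x
    rw [LinearMap.mem_ker, LinearMap.mem_ker, Subtype.ext_iff, Subtype.ext_iff]
    change Submodule.Quotient.mk x.1 = _ ↔ Submodule.Quotient.mk (f x.1) = _
    erw [Submodule.Quotient.mk_eq_zero, Submodule.Quotient.mk_eq_zero, hker x.1 x.2]
  exact ⟨(a.quotKerEquivOfSurjective ha).symm.trans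
    ((Submodule.quotEquivOfEq _ _ hab).trans (b.quotKerEquivOfSurjective hb))⟩

/-- Exactness in the horizontal direction identifies the two subquotients attached to
a corner of a double complex. -/
theorem Subquotient.nonempty_equiv_of_exact (h₀ : X₀ →ₗ[R] X) (h : X →ₗ[R] X₁)
    (k₀ : Z₀ →ₗ[R] Z) (k : Z →ₗ[R] Z₁) (v : X →ₗ[R] Z)
    (eh : Function.Exact h₀ h) (ek : Function.Exact k₀ k) :
    Nonempty (Subquotient (LinearMap.ker h ⊔ LinearMap.ker v) (LinearMap.ker (k ∘ₗ v)) ≃ₗ[R]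
      Subquotient (LinearMap.range (v ∘ₗ h₀)) (LinearMap.range v ⊓ LinearMap.range k₀)) := by
  refine Subquotient.nonempty_equiv v (fun x hx => ⟨⟨x, rfl⟩, (ek _).1 hx⟩) ?_ ?_
  · rintro _ ⟨⟨x, rfl⟩, hx⟩
    exact ⟨x, (ek _).2 hx, by simp⟩
  · intro x _
    constructor
    · rintro ⟨y, hy⟩
      rw [← add_sub_cancel (h₀ y) x]
      refine Submodule.add_mem_sup ((eh _).2 ⟨y, rfl⟩) ?_
      rw [LinearMap.mem_ker, map_sub, sub_eq_zero]
      exact hy.symm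
    · intro hx
      obtain ⟨y, hy, z, hz, rfl⟩ := Submodule.mem_sup.1 hx
      obtain ⟨w, rfl⟩ := (eh _).1 hy
      exact ⟨w, by simp [LinearMap.mem_ker.1 hz]⟩

/-- Vertical version of `Subquotient.nonempty_equiv_of_exact`, for a commutative square. -/
theorem Subquotient.nonempty_equiv_of_exact' (h₀ : X₀ →ₗ[R] X) (h : X →ₗ[R] X₁)
    (k₀ : Z₀ →ₗ[R] Z) (k : Z →ₗ[R] Z₁) (v : X →ₗ[R] Z) (v' : X₁ →ₗ[R] Z₁)
    (eh : Function.Exact h₀ h) (ek : Function.Exact k₀ k) (hcomm : v' ∘ₗ h = k ∘ₗ v) :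
    Nonempty (Subquotient (LinearMap.ker v ⊔ LinearMap.ker h) (LinearMap.ker (v' ∘ₗ h)) ≃ₗ[R]
      Subquotient (LinearMap.range (v ∘ₗ h₀)) (LinearMap.range k₀ ⊓ LinearMap.range v)) := by
  rw [hcomm, sup_comm, inf_comm]
  exact Subquotient.nonempty_equiv_of_exact h₀ h k₀ k v eh ek

end Subquotient

section DoubleComplex

variable {R : Type*} [Ring R]

/-- The cohomology of a complex embedded as the kernel at the edge of a double complex. -/
theorem Subquotient.nonempty_equiv_of_injective {B₀ B₁ B₂ X₀ X₁ X₂ : Type*}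
    [AddCommGroup B₀] [Module R B₀] [AddCommGroup B₁] [Module R B₁]
    [AddCommGroup B₂] [Module R B₂] [AddCommGroup X₀] [Module R X₀]
    [AddCommGroup X₁] [Module R X₁] [AddCommGroup X₂] [Module R X₂]
    (d₀ : B₀ →ₗ[R] B₁) (d₁ : B₁ →ₗ[R] B₂) (j₀ : B₀ →ₗ[R] X₀) (j₁ : B₁ →ₗ[R] X₁)
    (j₂ : B₂ →ₗ[R] X₂) (g₀ : X₀ →ₗ[R] X₁) (g₁ : X₁ →ₗ[R] X₂)
    (h₁ : Function.Injective j₁) (h₂ : Function.Injective j₂)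
    (hc₀ : j₁ ∘ₗ d₀ = g₀ ∘ₗ j₀) (hc₁ : j₂ ∘ₗ d₁ = g₁ ∘ₗ j₁) (hg : Function.Exact g₀ g₁) :
    Nonempty (Subquotient (LinearMap.range d₀) (LinearMap.ker d₁) ≃ₗ[R]
      Subquotient (LinearMap.range (g₀ ∘ₗ j₀)) (LinearMap.range g₀ ⊓ LinearMap.range j₁)) := by
  have hker : ∀ x, d₁ x = 0 ↔ g₁ (j₁ x) = 0 := fun x => by
    rw [← LinearMap.comp_apply, ← hc₁, LinearMap.comp_apply, map_eq_zero_iff _ h₂]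
  refine Subquotient.nonempty_equiv j₁
    (fun x hx => ⟨(hg _).1 ((hker x).1 hx), x, rfl⟩) ?_ ?_
  · rintro _ ⟨hx, x, rfl⟩
    exact ⟨x, (hker x).2 ((hg _).2 hx), by simp⟩
  · intro x _
    rw [← hc₀]
    constructor
    · rintro ⟨y, hy⟩
      exact ⟨y, h₁ hy⟩
    · rintro ⟨y, rfl⟩
      exact ⟨y, rfl⟩

/-- The homology of a complex which is the cokernel at the edge of a double complex. -/
theorem Subquotient.nonempty_equiv_of_surjective {B₀ B₁ B₂ X₀ X₁ Y₁ : Type*}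
    [AddCommGroup B₀] [Module R B₀] [AddCommGroup B₁] [Module R B₁]
    [AddCommGroup B₂] [Module R B₂] [AddCommGroup X₀] [Module R X₀]
    [AddCommGroup X₁] [Module R X₁] [AddCommGroup Y₁] [Module R Y₁]
    (d₀ : B₀ →ₗ[R] B₁) (d₁ : B₁ →ₗ[R] B₂) (j₀ : X₀ →ₗ[R] B₀) (j₁ : X₁ →ₗ[R] B₁)
    (g₀ : X₀ →ₗ[R] X₁) (g₁ : X₁ →ₗ[R] Y₁)
    (h₀ : Function.Surjective j₀) (h₁ : Function.Surjective j₁)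
    (hc₀ : j₁ ∘ₗ g₀ = d₀ ∘ₗ j₀) (hg : Function.Exact g₀ g₁) :
    Nonempty (Subquotient (LinearMap.ker j₁ ⊔ LinearMap.ker g₁) (LinearMap.ker (d₁ ∘ₗ j₁)) ≃ₗ[R]
      Subquotient (LinearMap.range d₀) (LinearMap.ker d₁)) := by
  refine Subquotient.nonempty_equiv j₁ (fun x hx => hx) ?_ ?_
  · intro y hy
    obtain ⟨x, rfl⟩ := h₁ y
    exact ⟨x, hy, by simp⟩
  · intro x _
    constructor
    · rintro ⟨y, hy⟩
      obtain ⟨z, rfl⟩ := h₀ y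
      rw [← LinearMap.comp_apply, ← hc₀, LinearMap.comp_apply] at hy
      rw [← sub_add_cancel x (g₀ z)]
      refine Submodule.add_mem_sup ?_ ((hg _).2 ⟨z, rfl⟩)
      rw [LinearMap.mem_ker, map_sub, hy, sub_self]
    · intro hx
      obtain ⟨y, hy, z, hz, rfl⟩ := Submodule.mem_sup.1 hx
      obtain ⟨w, rfl⟩ := (hg _).1 hz
      refine ⟨j₀ w, ?_⟩
      rw [map_add, LinearMap.mem_ker.1 hy, zero_add, ← LinearMap.comp_apply, ← hc₀,
        LinearMap.comp_apply]

theorem Subquotient.nonempty_equiv_ker_inf {D₀ D₁ Z X Y : Type*} [AddCommGroup D₀]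
    [Module R D₀] [AddCommGroup D₁] [Module R D₁] [AddCommGroup Z] [Module R Z]
    [AddCommGroup X] [Module R X] [AddCommGroup Y] [Module R Y]
    (d : D₀ →ₗ[R] D₁) (j₀ : D₀ →ₗ[R] Z) (j₁ : D₁ →ₗ[R] X) (g : Z →ₗ[R] X) (g' : Z →ₗ[R] Y)
    (h₀ : Function.Injective j₀) (h₁ : Function.Injective j₁)
    (hc : j₁ ∘ₗ d = g ∘ₗ j₀) (he : Function.Exact j₀ g') :
    Nonempty (Subquotient ⊥ (LinearMap.ker d) ≃ₗ[R]
      Subquotient ⊥ (LinearMap.ker g ⊓ LinearMap.ker g')) := by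
  have hker : ∀ x, d x = 0 ↔ g (j₀ x) = 0 := fun x => by
    rw [← LinearMap.comp_apply, ← hc, LinearMap.comp_apply, map_eq_zero_iff _ h₁]
  refine Subquotient.nonempty_equiv j₀ (fun x hx => ⟨(hker x).1 hx, (he _).2 ⟨x, rfl⟩⟩) ?_ ?_
  · rintro y ⟨hy, hy'⟩
    obtain ⟨x, rfl⟩ := (he y).1 hy'
    exact ⟨x, (hker x).2 hy, by simp⟩
  · intro x _
    simp [map_eq_zero_iff _ h₀]

variable {A : ℕ → ℕ → Type*} [∀ p q, AddCommGroup (A p q)] [∀ p q, Module R (A p q)]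
  {B : ℕ → Type*} [∀ p, AddCommGroup (B p)] [∀ p, Module R (B p)]
  {C : ℕ → Type*} [∀ q, AddCommGroup (C q)] [∀ q, Module R (C q)]

/-- In a first quadrant double complex with exact rows and columns, the two edge complexes have
isomorphic cohomology in positive degrees. -/
theorem nonempty_cohomology_equiv_of_doubleComplex
    (dh : ∀ p q, A p q →ₗ[R] A (p + 1) q) (dv : ∀ p q, A p q →ₗ[R] A p (q + 1))
    (comm : ∀ p q, dv (p + 1) q ∘ₗ dh p q = dh p (q + 1) ∘ₗ dv p q)
    (eh : ∀ p q, Function.Exact (dh p q) (dh (p + 1) q))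
    (ev : ∀ p q, Function.Exact (dv p q) (dv p (q + 1)))
    (dB : ∀ p, B p →ₗ[R] B (p + 1)) (ι : ∀ p, B p →ₗ[R] A p 0)
    (hι : ∀ p, Function.Injective (ι p)) (hιd : ∀ p, ι (p + 1) ∘ₗ dB p = dh p 0 ∘ₗ ι p)
    (eι : ∀ p, Function.Exact (ι p) (dv p 0))
    (dC : ∀ q, C q →ₗ[R] C (q + 1)) (ε : ∀ q, C q →ₗ[R] A 0 q)
    (hε : ∀ q, Function.Injective (ε q)) (hεd : ∀ q, ε (q + 1) ∘ₗ dC q = dv 0 q ∘ₗ ε q)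
    (eε : ∀ q, Function.Exact (ε q) (dh 0 q)) (n : ℕ) :
    Nonempty (Subquotient (LinearMap.range (dB n)) (LinearMap.ker (dB (n + 1))) ≃ₗ[R]
      Subquotient (LinearMap.range (dC n)) (LinearMap.ker (dC (n + 1)))) := by
  have step : ∀ p q, p + q = n →
      Nonempty (Subquotient (LinearMap.ker (dh p q) ⊔ LinearMap.ker (dv p q))
          (LinearMap.ker (dh p (q + 1) ∘ₗ dv p q)) ≃ₗ[R]
        Subquotient (LinearMap.ker (dh 0 n) ⊔ LinearMap.ker (dv 0 n))
          (LinearMap.ker (dh 0 (n + 1) ∘ₗ dv 0 n))) := by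
    intro p
    induction p with
    | zero =>
      intro q hq
      obtain rfl : q = n := by omega
      exact ⟨LinearEquiv.refl _ _⟩
    | succ p ih =>
      intro q hq
      obtain ⟨e₁⟩ := Subquotient.nonempty_equiv_of_exact (dh p q) (dh (p + 1) q)
        (dh p (q + 1)) (dh (p + 1) (q + 1)) (dv (p + 1) q) (eh p q) (eh p (q + 1))
      obtain ⟨e₂⟩ := Subquotient.nonempty_equiv_of_exact' (dv p q) (dv p (q + 1))
        (dv (p + 1) q) (dv (p + 1) (q + 1)) (dh p (q + 1)) (dh p (q + 2))
        (ev p q) (ev (p + 1) q) (comm p (q + 1)).symm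
      obtain ⟨e₃⟩ := ih (q + 1) (by omega)
      rw [← comm p q] at e₂
      exact ⟨e₁.trans (e₂.symm.trans e₃)⟩
  obtain ⟨e⟩ := step n 0 rfl
  obtain ⟨b₁⟩ := Subquotient.nonempty_equiv_of_injective (dB n) (dB (n + 1)) (ι n) (ι (n + 1))
    (ι (n + 2)) (dh n 0) (dh (n + 1) 0) (hι _) (hι _) (hιd _) (hιd _) (eh _ _)
  obtain ⟨b₂⟩ := Subquotient.nonempty_equiv_of_exact' (ι n) (dv n 0) (ι (n + 1)) (dv (n + 1) 0)
    (dh n 0) (dh n 1) (eι _) (eι _) (comm n 0).symm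
  obtain ⟨c₁⟩ := Subquotient.nonempty_equiv_of_injective (dC n) (dC (n + 1)) (ε n) (ε (n + 1))
    (ε (n + 2)) (dv 0 n) (dv 0 (n + 1)) (hε _) (hε _) (hεd _) (hεd _) (ev _ _)
  obtain ⟨c₂⟩ := Subquotient.nonempty_equiv_of_exact (ε n) (dh 0 n) (ε (n + 1)) (dh 0 (n + 1))
    (dv 0 n) (eε _) (eε _)
  rw [inf_comm] at b₂
  exact ⟨b₁.trans (b₂.symm.trans (e.trans (c₂.trans c₁.symm)))⟩

/-- In a first quadrant double complex, the two edge complexes have isomorphic cohomology in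
degree zero. -/
theorem nonempty_cohomology_zero_equiv_of_doubleComplex
    {A₀₀ A₁₀ A₀₁ B₀ B₁ C₀ C₁ : Type*} [AddCommGroup A₀₀] [Module R A₀₀]
    [AddCommGroup A₁₀] [Module R A₁₀] [AddCommGroup A₀₁] [Module R A₀₁]
    [AddCommGroup B₀] [Module R B₀] [AddCommGroup B₁] [Module R B₁]
    [AddCommGroup C₀] [Module R C₀] [AddCommGroup C₁] [Module R C₁]
    (dh : A₀₀ →ₗ[R] A₁₀) (dv : A₀₀ →ₗ[R] A₀₁)
    (dB : B₀ →ₗ[R] B₁) (ι₀ : B₀ →ₗ[R] A₀₀) (ι₁ : B₁ →ₗ[R] A₁₀)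
    (hι₀ : Function.Injective ι₀) (hι₁ : Function.Injective ι₁) (hιd : ι₁ ∘ₗ dB = dh ∘ₗ ι₀)
    (eι : Function.Exact ι₀ dv)
    (dC : C₀ →ₗ[R] C₁) (ε₀ : C₀ →ₗ[R] A₀₀) (ε₁ : C₁ →ₗ[R] A₀₁)
    (hε₀ : Function.Injective ε₀) (hε₁ : Function.Injective ε₁) (hεd : ε₁ ∘ₗ dC = dv ∘ₗ ε₀)
    (eε : Function.Exact ε₀ dh) :
    Nonempty (Subquotient ⊥ (LinearMap.ker dB) ≃ₗ[R] Subquotient ⊥ (LinearMap.ker dC)) := by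
  obtain ⟨e₁⟩ := Subquotient.nonempty_equiv_ker_inf dB ι₀ ι₁ dh dv hι₀ hι₁ hιd eι
  obtain ⟨e₂⟩ := Subquotient.nonempty_equiv_ker_inf dC ε₀ ε₁ dv dh hε₀ hε₁ hεd eε
  rw [inf_comm] at e₂
  exact ⟨e₁.trans e₂.symm⟩

end DoubleComplex

/-! ### Inhomogeneous cochains of a coinduced module -/

section CoinducedCochains

variable {R : Type*} [CommRing R] {G : Type*} [Group G]

/-- The differential of the inhomogeneous cochain complex of `G` with coefficients in the
coinduced module `G → R`, on which `a ∈ G` acts by `(a • u) x = χ a * u (a⁻¹ * x)`. -/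
def coindCoD (χ : G →* R) (q : ℕ) :
    (G → (Fin q → G) → R) →ₗ[R] (G → (Fin (q + 1) → G) → R) :=
  { toFun c x g := χ (g 0) * c ((g 0)⁻¹ * x) (fun i => g i.succ) +
      ∑ j : Fin (q + 1), ((-1 : ℤ) ^ ((j : ℕ) + 1)) • c x (Fin.contractNth j (· * ·) g)
    map_add' c c' := by
      ext x g
      simp only [Pi.add_apply, smul_add, Finset.sum_add_distrib]
      ring
    map_smul' r c := by
      ext x g
      simp only [Pi.smul_apply, smul_eq_mul, RingHom.id_apply, mul_add, Finset.mul_sum,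
        mul_smul_comm]
      ring }

theorem coindCoD_apply (χ : G →* R) (q : ℕ) (c : G → (Fin q → G) → R) (x : G)
    (g : Fin (q + 1) → G) :
    coindCoD χ q c x g = χ (g 0) * c ((g 0)⁻¹ * x) (fun i => g i.succ) +
      ∑ j : Fin (q + 1), ((-1 : ℤ) ^ ((j : ℕ) + 1)) • c x (Fin.contractNth j (· * ·) g) := rfl

/-- A contracting homotopy of the cochain complex of a coinduced module. -/
def coindHomotopy (χ : G →* R) (q : ℕ) (c : G → (Fin (q + 1) → G) → R) : G → (Fin q → G) → R :=
  fun x g => χ x * c 1 (Fin.cons x⁻¹ g)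

theorem coindCoD_translate (χ : G →* R) (q : ℕ) (c : G → (Fin q → G) → R) (a : G) :
    coindCoD χ q (fun x => c (x * a)) = fun x => coindCoD χ q c (x * a) := by
  ext x g
  simp only [coindCoD_apply, mul_assoc]

theorem Fin.contractNth_zero_cons {α : Type*} (op : α → α → α) {q : ℕ} (a : α)
    (g : Fin (q + 1) → α) :
    Fin.contractNth 0 op (Fin.cons a g : Fin (q + 2) → α) =
      Fin.cons (op a (g 0)) (fun i => g i.succ) := by
  ext i
  refine Fin.cases ?_ (fun i => ?_) i
  · rw [Fin.contractNth_apply_of_eq _ _ _ _ (by simp)]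
    simp
  · rw [Fin.contractNth_apply_of_gt _ _ _ _ (by simp)]
    simp

theorem Fin.contractNth_succ_cons {α : Type*} (op : α → α → α) {q : ℕ} (a : α)
    (g : Fin (q + 1) → α) (j : Fin (q + 1)) :
    Fin.contractNth j.succ op (Fin.cons a g : Fin (q + 2) → α) =
      Fin.cons a (Fin.contractNth j op g) := by
  ext i
  refine Fin.cases ?_ (fun i => ?_) i
  · rw [Fin.contractNth_apply_of_lt _ _ _ _ (by simp)]
    simp
  · rcases lt_trichotomy (i : ℕ) j with h | h | h
    · rw [Fin.contractNth_apply_of_lt _ _ _ _ (by simpa using h), Fin.cons_succ,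
        Fin.contractNth_apply_of_lt _ _ _ _ h, ← Fin.succ_castSucc, Fin.cons_succ]
    · rw [Fin.contractNth_apply_of_eq _ _ _ _ (by simpa using h), Fin.cons_succ,
        Fin.cons_succ, Fin.contractNth_apply_of_eq _ _ _ _ h, ← Fin.succ_castSucc, Fin.cons_succ]
    · rw [Fin.contractNth_apply_of_gt _ _ _ _ (by simpa using h), Fin.cons_succ,
        Fin.cons_succ, Fin.contractNth_apply_of_gt _ _ _ _ h]

theorem coindHomotopy_coindCoD_zero (χ : G →* R) (c : G → (Fin 0 → G) → R) :
    coindHomotopy χ 0 (coindCoD χ 0 c) = fun x g => c x g - χ x * c 1 g := by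
  ext x g
  have : χ x * χ x⁻¹ = 1 := by rw [← map_mul, mul_inv_cancel, map_one]
  simp [coindHomotopy, coindCoD_apply, mul_add, ← mul_assoc, this, Subsingleton.elim _ g,
    sub_eq_add_neg]

theorem coindHomotopy_coindCoD_succ (χ : G →* R) (q : ℕ) (c : G → (Fin (q + 1) → G) → R) :
    coindHomotopy χ (q + 1) (coindCoD χ (q + 1) c) =
      c - coindCoD χ q (coindHomotopy χ q c) := by
  ext x g
  have h : χ x * χ x⁻¹ = 1 := by rw [← map_mul, mul_inv_cancel, map_one]
  have h' : χ (g 0) * χ ((g 0)⁻¹ * x) = χ x := by rw [← map_mul, mul_inv_cancel_left]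
  rw [Pi.sub_apply, Pi.sub_apply, coindHomotopy, coindCoD_apply, coindCoD_apply,
    Fin.sum_univ_succ]
  simp only [coindHomotopy, Fin.cons_zero, Fin.cons_succ, Fin.contractNth_zero_cons,
    Fin.contractNth_succ_cons, mul_add, ← mul_assoc, h, h', inv_inv, mul_one, one_mul,
    Finset.mul_sum, mul_inv_rev, mul_smul_comm, Fin.val_succ, Fin.val_zero, zero_add, pow_one,
    pow_succ _ (_ + 1), mul_neg, neg_smul, one_smul, Finset.sum_neg_distrib]
  ring

theorem coindCoD_zero_eq_zero_iff (χ : G →* R) (c : G → (Fin 0 → G) → R) :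
    coindCoD χ 0 c = 0 ↔ ∀ x, c x = χ x • c 1 := by
  constructor
  · intro h x
    ext g
    have := congrFun (congrFun (coindHomotopy_coindCoD_zero χ c) x) g
    rw [h] at this
    simp only [coindHomotopy, Pi.zero_apply, mul_zero] at this
    simpa using (sub_eq_zero.1 this.symm)
  · intro h
    ext x g
    rw [coindCoD_apply, h x, h ((g 0)⁻¹ * x)]
    simp [← mul_assoc, ← map_mul,
      Subsingleton.elim (fun i => g i.succ) (Fin.contractNth 0 (· * ·) g)]

theorem eq_zero_of_coindHomotopy_eq_zero (χ : G →* R) (q : ℕ) (c : G → (Fin (q + 1) → G) → R)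
    (h : coindHomotopy χ q c = 0) : c 1 = 0 := by
  ext g
  have h' := congrFun (congrFun h (g 0)⁻¹) (fun i => g i.succ)
  have hg : (Fin.cons (g 0) (fun i => g i.succ) : Fin (q + 1) → G) = g := Fin.cons_self_tail g
  rw [coindHomotopy, inv_inv, hg] at h'
  have hu : χ (g 0) * χ (g 0)⁻¹ = 1 := by rw [← map_mul, mul_inv_cancel, map_one]
  rw [← one_mul (c 1 g), ← hu, mul_assoc, h']
  simp

theorem coindCoD_coindCoD (χ : G →* R) (q : ℕ) (c : G → (Fin q → G) → R) :
    coindCoD χ (q + 1) (coindCoD χ q c) = 0 := by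
  have of_homotopy : ∀ q, (∀ c, coindHomotopy χ (q + 1) (coindCoD χ (q + 1) (coindCoD χ q c)) = 0) →
      ∀ c, coindCoD χ (q + 1) (coindCoD χ q c) = 0 := by
    intro q h c
    ext x : 1
    have := eq_zero_of_coindHomotopy_eq_zero χ (q + 1) _ (h fun y => c (y * x))
    rw [coindCoD_translate, coindCoD_translate] at this
    simpa only [one_mul, Pi.zero_apply] using this
  induction q with
  | zero =>
    refine of_homotopy 0 (fun c => ?_) c
    rw [coindHomotopy_coindCoD_succ, ← map_sub, coindHomotopy_coindCoD_zero,
      coindCoD_zero_eq_zero_iff]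
    intro x
    ext g
    simp
  | succ q ih =>
    refine of_homotopy (q + 1) (fun c => ?_) c
    rw [coindHomotopy_coindCoD_succ, ← map_sub, coindHomotopy_coindCoD_succ, sub_sub_cancel, ih]

theorem coindCoD_exact (χ : G →* R) (q : ℕ) :
    Function.Exact (coindCoD χ q) (coindCoD χ (q + 1)) := by
  intro c
  constructor
  · intro hc
    refine ⟨coindHomotopy χ q c, ?_⟩
    have := coindHomotopy_coindCoD_succ χ q c
    rw [hc] at this
    rw [← sub_eq_zero, ← neg_sub, ← this]
    ext
    simp [coindHomotopy]
  · rintro ⟨b, rfl⟩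
    exact coindCoD_coindCoD χ q b

end CoinducedCochains

/-! ### Group cohomology of a right-angled Artin group as Koszul cohomology -/

section GroupCohomology

theorem LinearMap.compLeft_exact {R M M' M'' : Type*} [Ring R] [AddCommGroup M] [Module R M]
    [AddCommGroup M'] [Module R M'] [AddCommGroup M''] [Module R M'']
    {g : M →ₗ[R] M'} {h : M' →ₗ[R] M''} (he : Function.Exact g h) (I : Type*) :
    Function.Exact (g.compLeft I) (h.compLeft I) := by
  intro c
  constructor
  · intro hc
    choose b hb using fun i => (he (c i)).1 (congrFun hc i)
    exact ⟨b, funext hb⟩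
  · rintro ⟨b, rfl⟩
    ext i
    exact (he _).2 ⟨b i, rfl⟩

theorem RAAG.eq_of_forall_mul_of {n : ℕ} {Γ : SimpleGraph (Fin n)} {N : Type*} (u : RAAG Γ → N)
    (h : ∀ x i, u (x * PresentedGroup.of i) = u x) (x : RAAG Γ) : u x = u 1 := by
  suffices H : ∀ w : RAAG Γ, ∀ x, u (x * w) = u x by simpa using H x 1
  intro w
  have hw : w ∈ Subgroup.closure (Set.range (PresentedGroup.of (rels := raagRels Γ))) := by
    rw [PresentedGroup.closure_range_of]
    trivial
  induction hw using Subgroup.closure_induction with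
  | mem w hw =>
    obtain ⟨i, rfl⟩ := hw
    exact fun x => h x i
  | one => simp
  | mul a b _ _ ha hb => exact fun x => by rw [← mul_assoc, hb, ha]
  | inv a _ ha => exact fun x => by rw [← ha, inv_mul_cancel_right]

/-- A function on the faces of the clique complex of cardinality zero is a single value. -/
theorem cliqueComplex_card_zero {n : ℕ} (Γ : SimpleGraph (Fin n))
    (I : {I : Finset (Fin n) // I ∈ cliqueComplex Γ ∧ I.card = 0}) :
    I = ⟨∅, fun _ h => absurd h (Finset.notMem_empty _), rfl⟩ :=
  Subtype.ext (Finset.card_eq_zero.1 I.2.2)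

theorem constFaces_exact_koszulD {R N : Type*} [CommRing R] [AddCommGroup N] [Module R N]
    {n : ℕ} (Γ : SimpleGraph (Fin n)) :
    Function.Exact
      (fun (c : N) (_ : {I : Finset (Fin n) // I ∈ cliqueComplex Γ ∧ I.card = 0})
        (_ : RAAG Γ) => c)
      (koszulD (cliqueComplex Γ)
        (fun i => transSub (N := N) R (PresentedGroup.of i : RAAG Γ)) 0) := by
  have hempty : ∅ ∈ cliqueComplex Γ ∧ (∅ : Finset (Fin n)).card = 0 :=
    ⟨fun _ h => absurd h (Finset.notMem_empty _), rfl⟩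
  intro c
  have key : ∀ J : {I : Finset (Fin n) // I ∈ cliqueComplex Γ ∧ I.card = 0 + 1},
      ∃ i, J.1 = {i} ∧ koszulD (cliqueComplex Γ)
        (fun i => transSub (N := N) R (PresentedGroup.of i : RAAG Γ)) 0 c J =
          transSub R (PresentedGroup.of i) (c ⟨∅, hempty⟩) := by
    intro J
    obtain ⟨i, hi⟩ := Finset.card_eq_one.1 J.2.2
    refine ⟨i, hi, ?_⟩
    rw [koszulD_apply, hi, koszulTotal_singleton, extendFaces, dif_pos hempty]
  constructor
  · intro hc
    refine ⟨c ⟨∅, hempty⟩ 1, ?_⟩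
    ext I x
    obtain rfl := cliqueComplex_card_zero Γ I
    refine (RAAG.eq_of_forall_mul_of _ (fun x i => ?_) x).symm
    obtain ⟨j, hj, h⟩ := key ⟨{i}, by
      intro a ha b hb hab
      simp only [Finset.mem_singleton] at ha hb
      exact absurd (ha.trans hb.symm) hab, rfl⟩
    obtain rfl := Finset.singleton_injective hj
    rw [hc] at h
    exact sub_eq_zero.1 (congrFun h x).symm
  · rintro ⟨b, rfl⟩
    ext J x
    obtain ⟨i, -, h⟩ := key J
    rw [h, transSub_apply, sub_self]
    rfl

variable {n : ℕ} {Γ : SimpleGraph (Fin n)}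

theorem coindCoD_transSub {R : Type*} [CommRing R] {G : Type*} [Group G] (χ : G →* R) (q : ℕ)
    (a : G) (c : G → (Fin q → G) → R) :
    coindCoD χ q (transSub R a c) = transSub R a (coindCoD χ q c) := by
  ext x g
  simp only [coindCoD_apply, transSub_apply, Pi.sub_apply, mul_assoc, smul_sub,
    Finset.sum_sub_distrib]
  ring

/-- The group cohomology of a right-angled Artin group with coefficients in `k[ℤᵐ]` is the
cohomology of a Koszul-type complex on the clique complex. -/
theorem nonempty_groupCohomologyLaurent_equiv_koszul (k : Type) [Field k] {m n : ℕ}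
    (Γ : SimpleGraph (Fin n)) (φ : RAAG Γ →* Multiplicative (Fin m → ℤ))
    (T : Fin n → LaurentRing k m →ₗ[LaurentRing k m] LaurentRing k m)
    (hT : ∀ i r, T i r =
      AddMonoidAlgebra.single (Multiplicative.toAdd (φ (PresentedGroup.of i))) 1 * r - r) (q : ℕ) :
    Nonempty (groupCohomologyLaurent k φ q ≃ₗ[LaurentRing k m]
      Subquotient (LinearMap.range (koszulDpre (cliqueComplex Γ) T q))
        (LinearMap.ker (koszulD (cliqueComplex Γ) T q))) := by
  let R := LaurentRing k m
  let G := RAAG Γ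
  let χ : G →* R := (AddMonoidAlgebra.of k (Fin m → ℤ)).comp φ
  let A (p q : ℕ) := {I : Finset (Fin n) // I ∈ cliqueComplex Γ ∧ I.card = p} → G →
    (Fin q → G) → R
  let dh (p q : ℕ) : A p q →ₗ[R] A (p + 1) q :=
    koszulD (cliqueComplex Γ) (fun i => transSub R (PresentedGroup.of i : G)) p
  let dv (p q : ℕ) : A p q →ₗ[R] A p (q + 1) := (coindCoD χ q).compLeft _
  let ι₀ : R →ₗ[R] (G → (Fin 0 → G) → R) :=
    LinearMap.pi fun x => LinearMap.pi fun _ => χ x • LinearMap.id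
  have hι₀ : ∀ r x g, ι₀ r x g = χ x * r := fun _ _ _ => rfl
  let ι (p : ℕ) : ({I : Finset (Fin n) // I ∈ cliqueComplex Γ ∧ I.card = p} → R) →ₗ[R] A p 0 :=
    ι₀.compLeft _
  let ε (q : ℕ) : ((Fin q → G) → R) →ₗ[R] A 0 q :=
    LinearMap.pi fun _ => LinearMap.pi fun _ => LinearMap.id
  have comm : ∀ p q, dv (p + 1) q ∘ₗ dh p q = dh p (q + 1) ∘ₗ dv p q := fun p q =>
    LinearMap.ext fun c => (koszulD_comp _ _ _ (fun i x => coindCoD_transSub χ q _ x) p c).symm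
  have hι : ∀ p, Function.Injective (ι p) := by
    intro p r r' h
    ext1 I
    have : χ 1 * r I = χ 1 * r' I := congrFun (congrFun (congrFun h I) 1) Fin.elim0
    rwa [map_one, one_mul, one_mul] at this
  have hι₀T : ∀ i r, ι₀ (T i r) = transSub R (PresentedGroup.of i : G) (ι₀ r) := by
    intro i r
    ext1 x
    ext1 g
    rw [transSub_apply, Pi.sub_apply, hι₀, hι₀, hι₀, hT, map_mul, mul_sub, ← mul_assoc]
    rfl
  have hιd : ∀ p, ι (p + 1) ∘ₗ koszulD (cliqueComplex Γ) T p = dh p 0 ∘ₗ ι p := fun p =>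
    LinearMap.ext fun c => (koszulD_comp T _ ι₀ hι₀T p c).symm
  have eι₀ : Function.Exact ι₀ (coindCoD χ 0) := by
    intro c
    rw [coindCoD_zero_eq_zero_iff]
    constructor
    · intro h
      refine ⟨c 1 Fin.elim0, ?_⟩
      ext1 x
      ext1 g
      rw [hι₀, h x, Subsingleton.elim g Fin.elim0]
      rfl
    · rintro ⟨r, rfl⟩ x
      ext1 g
      rw [hι₀, Pi.smul_apply, hι₀, map_one, one_mul, smul_eq_mul]
  have eι : ∀ p, Function.Exact (ι p) (dv p 0) := fun p => LinearMap.compLeft_exact eι₀ _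
  have hε : ∀ q, Function.Injective (ε q) := fun q c c' h =>
    congrFun (congrFun h ⟨∅, fun _ h => absurd h (Finset.notMem_empty _), rfl⟩) 1
  have hεd : ∀ q, ε (q + 1) ∘ₗ inhomogCoD k φ q = dv 0 q ∘ₗ ε q := by
    intro q
    ext1 c
    ext1 I
    ext1 x
    ext1 g
    change inhomogCoD k φ q c g = coindCoD χ q (fun _ => c) x g
    simp [coindCoD_apply, inhomogCoD, yMul, χ]
    rfl
  have eε : ∀ q, Function.Exact (ε q) (dh 0 q) := fun q => constFaces_exact_koszulD Γ
  cases q with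
  | zero =>
    obtain ⟨e⟩ := nonempty_cohomology_zero_equiv_of_doubleComplex (dh 0 0) (dv 0 0)
      (koszulD (cliqueComplex Γ) T 0) (ι 0) (ι 1) (hι _) (hι _) (hιd _) (eι _)
      (inhomogCoD k φ 0) (ε 0) (ε 1) (hε _) (hε _) (hεd _) (eε _)
    change Nonempty (Subquotient (LinearMap.range
      (0 : inhomogCochains k m (RAAG Γ) (0 - 1) →ₗ[R] _)) (LinearMap.ker (inhomogCoD k φ 0)) ≃ₗ[R]
        Subquotient (LinearMap.range
          (0 : ({I : Finset (Fin n) // I ∈ cliqueComplex Γ ∧ I.card = 0 - 1} → R) →ₗ[R] _)) _)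
    rw [LinearMap.range_zero, LinearMap.range_zero]
    exact ⟨e.symm⟩
  | succ q =>
    obtain ⟨e⟩ := nonempty_cohomology_equiv_of_doubleComplex dh dv comm
      (fun p q => koszulD_transSub_exact Γ p)
      (fun p q => LinearMap.compLeft_exact (coindCoD_exact χ q) _)
      (koszulD (cliqueComplex Γ) T) ι hι hιd eι (inhomogCoD k φ) ε hε hεd eε q
    exact ⟨e.symm⟩

end GroupCohomology

section MixedDoubleComplex

variable {R : Type*} [Ring R]
  {A : ℕ → ℕ → Type*} [∀ p q, AddCommGroup (A p q)] [∀ p q, Module R (A p q)]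
  {B : ℕ → Type*} [∀ p, AddCommGroup (B p)] [∀ p, Module R (B p)]
  {C : ℕ → Type*} [∀ q, AddCommGroup (C q)] [∀ q, Module R (C q)]

/-- In a double complex which is a cochain complex in the first and a chain complex in the second
direction, with exact columns resolving `B` and with rows which are exact except for a cokernel `C`
at the end, the cohomology of `B` is the homology of `C`. -/
theorem nonempty_cohomology_equiv_homology_of_doubleComplex
    (dh : ∀ p q, A p q →ₗ[R] A (p + 1) q) (dv : ∀ p q, A p (q + 1) →ₗ[R] A p q)
    (comm : ∀ p q, dh p q ∘ₗ dv p q = dv (p + 1) q ∘ₗ dh p (q + 1)) (d : ℕ)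
    (eh : ∀ p q, p < d → Function.Exact (dh p q) (dh (p + 1) q))
    (ev : ∀ p q, Function.Exact (dv p (q + 1)) (dv p q))
    (dB : ∀ p, B p →ₗ[R] B (p + 1)) (π : ∀ p, A p 0 →ₗ[R] B p)
    (hπ : ∀ p, Function.Surjective (π p)) (hπd : ∀ p, π (p + 1) ∘ₗ dh p 0 = dB p ∘ₗ π p)
    (eπ : ∀ p, Function.Exact (dv p 0) (π p))
    (dC : ∀ q, C (q + 1) →ₗ[R] C q) (ε : ∀ q, A (d + 1) q →ₗ[R] C q)
    (hε : ∀ q, Function.Surjective (ε q)) (hεd : ∀ q, ε q ∘ₗ dv (d + 1) q = dC q ∘ₗ ε (q + 1))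
    (eε : ∀ q, Function.Exact (dh d q) (ε q))
    {X₀ B₀ : Type*} [AddCommGroup X₀] [Module R X₀] [AddCommGroup B₀] [Module R B₀]
    {p : ℕ} (g₀ : X₀ →ₗ[R] A p 0) (d₀ : B₀ →ₗ[R] B p) (j₀ : X₀ →ₗ[R] B₀)
    (hj₀ : Function.Surjective j₀) (hc₀ : π p ∘ₗ g₀ = d₀ ∘ₗ j₀)
    (eg₀ : Function.Exact g₀ (dh p 0)) (j : ℕ) (hj : p + j = d) :
    Nonempty (Subquotient (LinearMap.range d₀) (LinearMap.ker (dB p)) ≃ₗ[R]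
      Subquotient (LinearMap.range (dC (j + 1))) (LinearMap.ker (dC j))) := by
  have step : ∀ i, ∀ a, a + i = d → ∀ q, Nonempty
      (Subquotient (LinearMap.range (dh a q ∘ₗ dv a q))
          (LinearMap.range (dh a q) ⊓ LinearMap.range (dv (a + 1) q)) ≃ₗ[R]
        Subquotient (LinearMap.range (dC (q + i + 1))) (LinearMap.ker (dC (q + i)))) := by
    intro i
    induction i with
    | zero =>
      rintro a rfl q
      obtain ⟨e₁⟩ := Subquotient.nonempty_equiv_of_exact (dh a (q + 1)) (ε (q + 1))
        (dh a q) (ε q) (dv (a + 1) q) (eε _) (eε _)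
      obtain ⟨e₂⟩ := Subquotient.nonempty_equiv_of_surjective (dC (q + 1)) (dC q) (ε (q + 2))
        (ε (q + 1)) (dv (a + 1) (q + 1)) (dv (a + 1) q) (hε _) (hε _) (hεd _) (ev _ _)
      rw [hεd, ← comm, inf_comm] at e₁
      exact ⟨e₁.symm.trans e₂⟩
    | succ i ih =>
      intro a ha q
      obtain ⟨e₁⟩ := Subquotient.nonempty_equiv_of_exact (dh a (q + 1)) (dh (a + 1) (q + 1))
        (dh a q) (dh (a + 1) q) (dv (a + 1) q) (eh _ _ (by omega)) (eh _ _ (by omega))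
      obtain ⟨e₂⟩ := Subquotient.nonempty_equiv_of_exact' (dv (a + 1) (q + 1)) (dv (a + 1) q)
        (dv (a + 2) (q + 1)) (dv (a + 2) q) (dh (a + 1) (q + 1)) (dh (a + 1) q)
        (ev _ _) (ev _ _) (comm _ _)
      obtain ⟨e₃⟩ := ih (a + 1) (by omega) (q + 1)
      rw [← comm a q, inf_comm] at e₁
      rw [inf_comm] at e₂
      rw [show q + (i + 1) = q + 1 + i by omega]
      exact ⟨e₁.symm.trans (e₂.trans e₃)⟩
  obtain ⟨e₁⟩ := Subquotient.nonempty_equiv_of_surjective d₀ (dB p) j₀ (π p) g₀ (dh p 0)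
    hj₀ (hπ _) hc₀ eg₀
  obtain ⟨e₂⟩ := Subquotient.nonempty_equiv_of_exact (dv p 0) (π p) (dv (p + 1) 0) (π (p + 1))
    (dh p 0) (eπ _) (eπ _)
  obtain ⟨e₃⟩ := step j p hj 0
  rw [hπd] at e₂
  rw [← zero_add j]
  exact ⟨e₁.symm.trans (e₂.trans e₃)⟩

/-- The cokernels of two edge maps at a corner of a double complex are isomorphic. -/
theorem nonempty_cokernel_equiv_of_doubleComplex
    {X Xh Xv B₀ B₁ C₀ C₁ : Type*} [AddCommGroup X] [Module R X]
    [AddCommGroup Xh] [Module R Xh] [AddCommGroup Xv] [Module R Xv]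
    [AddCommGroup B₀] [Module R B₀] [AddCommGroup B₁] [Module R B₁]
    [AddCommGroup C₀] [Module R C₀] [AddCommGroup C₁] [Module R C₁]
    (dh : Xh →ₗ[R] X) (dv : Xv →ₗ[R] X)
    (dB : B₀ →ₗ[R] B₁) (π₀ : Xh →ₗ[R] B₀) (π₁ : X →ₗ[R] B₁)
    (hπ₀ : Function.Surjective π₀) (hπ₁ : Function.Surjective π₁) (hπd : π₁ ∘ₗ dh = dB ∘ₗ π₀)
    (eπ : Function.Exact dv π₁)
    (dC : C₀ →ₗ[R] C₁) (ε₀ : Xv →ₗ[R] C₀) (ε₁ : X →ₗ[R] C₁)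
    (hε₀ : Function.Surjective ε₀) (hε₁ : Function.Surjective ε₁) (hεd : ε₁ ∘ₗ dv = dC ∘ₗ ε₀)
    (eε : Function.Exact dh ε₁) :
    Nonempty (Subquotient (LinearMap.range dB) ⊤ ≃ₗ[R] Subquotient (LinearMap.range dC) ⊤) := by
  obtain ⟨e₁⟩ := Subquotient.nonempty_equiv_of_surjective dB (0 : B₁ →ₗ[R] X) π₀ π₁ dh ε₁
    hπ₀ hπ₁ hπd eε
  obtain ⟨e₂⟩ := Subquotient.nonempty_equiv_of_surjective dC (0 : C₁ →ₗ[R] X) ε₀ ε₁ dv π₁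
    hε₀ hε₁ hεd eπ
  rw [LinearMap.zero_comp, LinearMap.ker_zero, LinearMap.ker_zero] at e₁ e₂
  rw [sup_comm] at e₂
  exact ⟨e₁.symm.trans e₂⟩

end MixedDoubleComplex

/-! ### Koszul complexes with flat coefficients -/

section KoszulTensor

open scoped TensorProduct

variable {S : Type*} [CommRing S] {n : ℕ} (K : Set (Finset (Fin n))) (t : Fin n → S)
  (M : Type*) [AddCommGroup M] [Module S M]

/-- The Koszul differential with coefficients in `M` of a sequence of elements of the ring. -/
abbrev koszulMulD (p : ℕ) : ({I : Finset (Fin n) // I ∈ K ∧ I.card = p} → M) →ₗ[S]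
    ({I : Finset (Fin n) // I ∈ K ∧ I.card = p + 1} → M) :=
  koszulD K (fun i => LinearMap.lsmul S M (t i)) p

/-- The Koszul differential entering degree `p`, with coefficients in `M`. -/
abbrev koszulMulDpre (p : ℕ) : ({I : Finset (Fin n) // I ∈ K ∧ I.card = p - 1} → M) →ₗ[S]
    ({I : Finset (Fin n) // I ∈ K ∧ I.card = p} → M) :=
  koszulDpre K (fun i => LinearMap.lsmul S M (t i)) p

theorem koszulMulD_comp {M M' : Type*} [AddCommGroup M] [Module S M] [AddCommGroup M']
    [Module S M'] (g : M →ₗ[S] M') (p : ℕ) :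
    koszulMulD K t M' p ∘ₗ g.compLeft _ = g.compLeft _ ∘ₗ koszulMulD K t M p :=
  LinearMap.ext fun c => koszulD_comp _ _ g (fun i x => map_smul g (t i) x) p c

theorem koszulMulDpre_comp {M M' : Type*} [AddCommGroup M] [Module S M] [AddCommGroup M']
    [Module S M'] (g : M →ₗ[S] M') (p : ℕ) :
    koszulMulDpre K t M' p ∘ₗ g.compLeft _ = g.compLeft _ ∘ₗ koszulMulDpre K t M p := by
  cases p with
  | zero => ext; simp [koszulMulDpre, koszulDpre]
  | succ p => exact koszulMulD_comp K t g p

theorem piScalarRight_lTensor_koszulMulD (p : ℕ) :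
    (TensorProduct.piScalarRight S S M _).toLinearMap ∘ₗ (koszulMulD K t S p).lTensor M =
      koszulMulD K t M p ∘ₗ (TensorProduct.piScalarRight S S M _).toLinearMap := by
  refine TensorProduct.ext' fun x c => ?_
  have := LinearMap.congr_fun (koszulMulD_comp K t (LinearMap.toSpanSingleton S M x) p) c
  simp only [LinearMap.comp_apply, LinearMap.lTensor_tmul, LinearEquiv.coe_coe,
    TensorProduct.piScalarRight_apply, TensorProduct.piScalarRightHom_tmul]
  exact this.symm

theorem piScalarRight_lTensor_koszulMulDpre (p : ℕ) :
    (TensorProduct.piScalarRight S S M _).toLinearMap ∘ₗ (koszulMulDpre K t S p).lTensor M =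
      koszulMulDpre K t M p ∘ₗ (TensorProduct.piScalarRight S S M _).toLinearMap := by
  cases p with
  | zero => simp [koszulMulDpre, koszulDpre]
  | succ p => exact piScalarRight_lTensor_koszulMulD K t M p

theorem koszulMulD_exact_of_flat [Module.Flat S M] (p : ℕ)
    (h : Function.Exact (koszulMulDpre K t S p) (koszulMulD K t S p)) :
    Function.Exact (koszulMulDpre K t M p) (koszulMulD K t M p) :=
  Function.Exact.of_ladder_linearEquiv_of_exact
    (piScalarRight_lTensor_koszulMulDpre K t M p).symm
    (piScalarRight_lTensor_koszulMulD K t M p).symm (Module.Flat.lTensor_exact M h)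

/-- The edge map from top-dimensional Koszul cochains with coefficients in `M` to the tensor
product of `M` with the cokernel `F` of the Koszul differential. -/
def koszulEdge {p : ℕ} {F : Type*} [AddCommGroup F] [Module S F]
    (r : ({I : Finset (Fin n) // I ∈ K ∧ I.card = p} → S) →ₗ[S] F) :
    ({I : Finset (Fin n) // I ∈ K ∧ I.card = p} → M) →ₗ[S] TensorProduct S F M :=
  (TensorProduct.comm S M F).toLinearMap ∘ₗ r.lTensor M ∘ₗ
    (TensorProduct.piScalarRight S S M _).symm.toLinearMap

variable {p : ℕ} {F : Type*} [AddCommGroup F] [Module S F]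
    (r : ({I : Finset (Fin n) // I ∈ K ∧ I.card = p + 1} → S) →ₗ[S] F)

theorem koszulEdge_surjective (hr : Function.Surjective r) :
    Function.Surjective (koszulEdge K M r) :=
  (TensorProduct.comm S M F).surjective.comp
    ((LinearMap.lTensor_surjective M hr).comp
      (TensorProduct.piScalarRight S S M _).symm.surjective)

theorem koszulMulD_koszulEdge_exact (hr : Function.Surjective r)
    (h : Function.Exact (koszulMulD K t S p) r) :
    Function.Exact (koszulMulD K t M p) (koszulEdge K M r) :=
  Function.Exact.of_ladder_linearEquiv_of_exact
    (piScalarRight_lTensor_koszulMulD K t M p).symm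
    (e₃ := TensorProduct.comm S M F)
    (LinearMap.ext fun x => by simp only [koszulEdge, LinearMap.comp_apply, LinearEquiv.coe_coe,
      LinearEquiv.symm_apply_apply]) (lTensor_exact M h hr)

theorem koszulEdge_comp {M M' : Type*} [AddCommGroup M] [Module S M] [AddCommGroup M']
    [Module S M'] (g : M →ₗ[S] M') :
    koszulEdge K M' r ∘ₗ g.compLeft _ = g.lTensor F ∘ₗ koszulEdge K M r := by
  have h : koszulEdge K M' r ∘ₗ g.compLeft _ ∘ₗ
      (TensorProduct.piScalarRight S S M _).toLinearMap =
        g.lTensor F ∘ₗ koszulEdge K M r ∘ₗ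
          (TensorProduct.piScalarRight S S M _).toLinearMap := by
    refine TensorProduct.ext' fun x c => ?_
    have hc : g.compLeft _ (TensorProduct.piScalarRight S S M _ (x ⊗ₜ c)) =
        TensorProduct.piScalarRight S S M' _ (g x ⊗ₜ c) := by
      ext I
      simp
    simp only [koszulEdge, LinearMap.comp_apply, LinearEquiv.coe_coe, hc,
      LinearEquiv.symm_apply_apply, LinearMap.lTensor_tmul, TensorProduct.comm_tmul]
  refine LinearMap.ext fun c => ?_
  have := LinearMap.congr_fun h ((TensorProduct.piScalarRight S S M _).symm c)
  simpa only [LinearMap.comp_apply, LinearEquiv.coe_coe, LinearEquiv.apply_symm_apply] using this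

end KoszulTensor

/-! ### `Tor` from a projective resolution -/

section TorResolution

theorem ShortComplex.nonempty_homology_equiv_subquotient {S : Type} [CommRing S]
    (X : ShortComplex (ModuleCat.{0} S)) :
    Nonempty (X.homology ≃ₗ[S]
      Subquotient (LinearMap.range X.f.hom) (LinearMap.ker X.g.hom)) := by
  let a : LinearMap.ker X.g.hom →ₗ[S]
      Subquotient (LinearMap.range X.f.hom) (LinearMap.ker X.g.hom) :=
    (LinearMap.range X.f.hom).mkQ.submoduleMap _
  have ha : Function.Surjective a := LinearMap.submoduleMap_surjective _ _
  have hk : LinearMap.range X.moduleCatToCycles = LinearMap.ker a := by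
    ext x
    rw [LinearMap.mem_ker, ← Subtype.coe_inj]
    change _ ↔ (LinearMap.range X.f.hom).mkQ x.1 = 0
    rw [Submodule.mkQ_apply, Submodule.Quotient.mk_eq_zero]
    constructor
    · rintro ⟨y, rfl⟩
      exact ⟨y, rfl⟩
    · rintro ⟨y, hy⟩
      exact ⟨y, Subtype.ext hy⟩
  exact ⟨X.moduleCatHomologyIso.toLinearEquiv.trans
    ((Submodule.quotEquivOfEq _ _ hk).trans (a.quotKerEquivOfSurjective ha))⟩

/-- `Tor` in positive degrees as the homology of the tensor product with a resolution. -/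
theorem nonempty_tor_succ_equiv {S : Type} [CommRing S] (F L : ModuleCat.{0} S)
    (P : ProjectiveResolution L) (j : ℕ) :
    Nonempty (((Tor (ModuleCat.{0} S) (j + 1)).obj F).obj L ≃ₗ[S]
      Subquotient (LinearMap.range ((P.complex.d (j + 2) (j + 1)).hom.lTensor F))
        (LinearMap.ker ((P.complex.d (j + 1) j).hom.lTensor F))) := by
  have e₁ := (P.isoLeftDerivedObj ((MonoidalCategory.tensoringLeft (ModuleCat.{0} S)).obj F)
    (j + 1)).toLinearEquiv
  let Q := (((MonoidalCategory.tensoringLeft (ModuleCat.{0} S)).obj F).mapHomologicalComplex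
    (ComplexShape.down ℕ)).obj P.complex
  have e₂ := (ShortComplex.homologyMapIso
    (Q.isoSc' (j + 2) (j + 1) j (by simp) (by simp))).toLinearEquiv
  obtain ⟨e₃⟩ := ShortComplex.nonempty_homology_equiv_subquotient (Q.sc' (j + 2) (j + 1) j)
  exact ⟨e₁.trans (e₂.trans e₃)⟩

/-- `Tor` in degree zero as the homology of the tensor product with a resolution. -/
theorem nonempty_tor_zero_equiv {S : Type} [CommRing S] (F L : ModuleCat.{0} S)
    (P : ProjectiveResolution L) :
    Nonempty (((Tor (ModuleCat.{0} S) 0).obj F).obj L ≃ₗ[S]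
      Subquotient (LinearMap.range ((P.complex.d 1 0).hom.lTensor F)) ⊤) := by
  have e₁ := (P.isoLeftDerivedObj ((MonoidalCategory.tensoringLeft (ModuleCat.{0} S)).obj F)
    0).toLinearEquiv
  let Q := (((MonoidalCategory.tensoringLeft (ModuleCat.{0} S)).obj F).mapHomologicalComplex
    (ComplexShape.down ℕ)).obj P.complex
  have e₂ := (ShortComplex.homologyMapIso (Q.isoSc' 1 0 0 (by simp) (by simp))).toLinearEquiv
  obtain ⟨e₃⟩ := ShortComplex.nonempty_homology_equiv_subquotient (Q.sc' 1 0 0)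
  have h : (Q.sc' 1 0 0).g = 0 := Q.shape _ _ (by simp)
  rw [h, ModuleCat.hom_zero, LinearMap.ker_zero] at e₃
  exact ⟨e₁.trans (e₂.trans e₃)⟩

theorem ProjectiveResolution.exists_augmentation {S : Type} [CommRing S] {L : ModuleCat.{0} S}
    (P : ProjectiveResolution L) : ∃ π : P.complex.X 0 →ₗ[S] L, Function.Surjective π ∧
      Function.Exact (P.complex.d 1 0).hom π :=
  ⟨(P.π.f 0).hom, (ModuleCat.epi_iff_surjective _).1 (inferInstanceAs (Epi (P.π.f 0))),
    (ShortComplex.ShortExact.moduleCat_exact_iff_function_exact _).1 P.exact₀⟩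

theorem ProjectiveResolution.function_exact_succ {S : Type} [CommRing S] {L : ModuleCat.{0} S}
    (P : ProjectiveResolution L) (q : ℕ) :
    Function.Exact (P.complex.d (q + 2) (q + 1)).hom (P.complex.d (q + 1) q).hom :=
  (ShortComplex.ShortExact.moduleCat_exact_iff_function_exact _).1 (P.exact_succ q)

theorem ProjectiveResolution.flat {S : Type} [CommRing S] {L : ModuleCat.{0} S}
    (P : ProjectiveResolution L) (q : ℕ) : Module.Flat S (P.complex.X q) := by
  have := P.projective q
  have := (IsProjective.iff_projective (R := S) (P.complex.X q)).2 this
  infer_instance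

end TorResolution

/-! ### Koszul cohomology and `Tor` -/

section KoszulTor

variable {S : Type} [CommRing S] {n : ℕ} (K : Set (Finset (Fin n))) (t : Fin n → S)
  (F L : ModuleCat.{0} S) {d : ℕ}
  (r : ({I : Finset (Fin n) // I ∈ K ∧ I.card = d + 1} → S) →ₗ[S] F)

theorem nonempty_koszul_equiv_tor (hr : Function.Surjective r)
    (er : Function.Exact (koszulMulD K t S d) r)
    (h : ∀ p ≤ d, Function.Exact (koszulMulDpre K t S p) (koszulMulD K t S p))
    {q : ℕ} (hq : q ≤ d) :
    Nonempty (Subquotient (LinearMap.range (koszulMulDpre K t L q))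
        (LinearMap.ker (koszulMulD K t L q)) ≃ₗ[S]
      ((Tor (ModuleCat.{0} S) (d + 1 - q)).obj F).obj L) := by
  let P := ProjectiveResolution.of L
  have := ProjectiveResolution.flat P
  obtain ⟨π, hπ, eπ⟩ := ProjectiveResolution.exists_augmentation P
  obtain ⟨j, rfl⟩ := Nat.exists_eq_add_of_le hq
  obtain ⟨e₁⟩ := nonempty_cohomology_equiv_homology_of_doubleComplex
    (A := fun p q => {I : Finset (Fin n) // I ∈ K ∧ I.card = p} → P.complex.X q)
    (B := fun p => {I : Finset (Fin n) // I ∈ K ∧ I.card = p} → L)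
    (C := fun q => TensorProduct S F (P.complex.X q))
    (fun p q => koszulMulD K t (P.complex.X q) p)
    (fun p q => (P.complex.d (q + 1) q).hom.compLeft _)
    (fun p q => koszulMulD_comp K t _ p) (q + j)
    (fun p i hp => koszulMulD_exact_of_flat K t _ (p + 1) (h _ (by omega)))
    (fun p i => LinearMap.compLeft_exact (ProjectiveResolution.function_exact_succ P i) _)
    (koszulMulD K t L) (fun p => π.compLeft _)
    (fun p => hπ.comp_left)
    (fun p => (koszulMulD_comp K t π p).symm)
    (fun p => LinearMap.compLeft_exact eπ _)
    (fun q => (P.complex.d (q + 1) q).hom.lTensor F)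
    (fun i => koszulEdge K _ r) (fun i => koszulEdge_surjective K _ r hr)
    (fun i => koszulEdge_comp K r _)
    (fun i => koszulMulD_koszulEdge_exact K t _ r hr er)
    (koszulMulDpre K t (P.complex.X 0) q) (koszulMulDpre K t L q) (π.compLeft _)
    hπ.comp_left (koszulMulDpre_comp K t π q).symm
    (koszulMulD_exact_of_flat K t _ q (h _ hq)) j rfl
  obtain ⟨e₂⟩ := nonempty_tor_succ_equiv F L P j
  rw [show q + j + 1 - q = j + 1 by omega]
  exact ⟨e₁.trans e₂.symm⟩

theorem nonempty_koszul_top_equiv_tor (hr : Function.Surjective r)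
    (er : Function.Exact (koszulMulD K t S d) r) :
    Nonempty (Subquotient (LinearMap.range (koszulMulD K t L d)) ⊤ ≃ₗ[S]
      ((Tor (ModuleCat.{0} S) 0).obj F).obj L) := by
  let P := ProjectiveResolution.of L
  obtain ⟨π, hπ, eπ⟩ := ProjectiveResolution.exists_augmentation P
  obtain ⟨e₁⟩ := nonempty_cokernel_equiv_of_doubleComplex
    (koszulMulD K t (P.complex.X 0) d) ((P.complex.d 1 0).hom.compLeft _)
    (koszulMulD K t L d) (π.compLeft _) (π.compLeft _) hπ.comp_left hπ.comp_left
    (koszulMulD_comp K t π d).symm (LinearMap.compLeft_exact eπ _)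
    ((P.complex.d 1 0).hom.lTensor F) (koszulEdge K _ r) (koszulEdge K _ r)
    (koszulEdge_surjective K _ r hr) (koszulEdge_surjective K _ r hr)
    (koszulEdge_comp K r _) (koszulMulD_koszulEdge_exact K t _ r hr er)
  obtain ⟨e₂⟩ := nonempty_tor_zero_equiv F L P
  exact ⟨e₁.trans e₂.symm⟩

end KoszulTor

/-! ### Concentrated Cartan cohomology -/

section Cartan

variable (k : Type) [Field k] {n : ℕ} (Γ : SimpleGraph (Fin n))

theorem cartanD_eq_koszulMulD (K : Set (Finset (Fin n))) (p : ℕ) :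
    cartanD k K p = koszulMulD K MvPolynomial.X (polyRing k n) p := rfl

theorem cartanDpre_eq_koszulMulDpre (K : Set (Finset (Fin n))) (p : ℕ) :
    cartanDpre k K p = koszulMulDpre K MvPolynomial.X (polyRing k n) p := by
  cases p <;> rfl

theorem cartan_exact_of_subsingleton {p : ℕ}
    (h : Subsingleton (cartanCohomology k (cliqueComplex Γ) p)) :
    Function.Exact (cartanDpre k (cliqueComplex Γ) p) (cartanD k (cliqueComplex Γ) p) := by
  intro c
  constructor
  · intro hc
    have h0 : (LinearMap.range (cartanDpre k (cliqueComplex Γ) p)).mkQ c = 0 :=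
      congrArg Subtype.val (h.elim (⟨_, c, hc, rfl⟩ : ↥(Submodule.map
        (LinearMap.range (cartanDpre k (cliqueComplex Γ) p)).mkQ
        (LinearMap.ker (cartanD k (cliqueComplex Γ) p)))) 0)
    rwa [Submodule.mkQ_apply, Submodule.Quotient.mk_eq_zero] at h0
  · rintro ⟨b, rfl⟩
    cases p with
    | zero => exact map_zero _
    | succ p =>
      rw [cartanD_eq_koszulMulD]
      refine koszulD_koszulD _ (fun i j _ x => ?_) p b
      exact smul_comm (MvPolynomial.X (R := k) i) (MvPolynomial.X j) x

theorem card_le_of_cartan_concentrated {d : ℕ}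
    (hvanish : ∀ p : ℕ, p ≠ d + 1 → Subsingleton (cartanCohomology k (cliqueComplex Γ) p)) :
    ∀ σ ∈ cliqueComplex Γ, σ.card ≤ d + 1 := by
  suffices h : ∀ j, ∀ σ ∈ cliqueComplex Γ, d + 1 < σ.card → σ.card + j ≠ n + 1 by
    intro σ hσ
    by_contra! hlt
    have := σ.card_le_univ
    rw [Fintype.card_fin] at this
    exact h (n + 1 - σ.card) σ hσ hlt (by omega)
  intro j
  induction j with
  | zero =>
    intro σ hσ hlt
    have := σ.card_le_univ
    rw [Fintype.card_fin] at this
    omega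
  | succ j ih =>
    intro σ hσ hlt hj
    obtain ⟨p, hp⟩ : ∃ p, σ.card = p + 1 := ⟨σ.card - 1, by omega⟩
    have hex := cartan_exact_of_subsingleton k Γ (hvanish (p + 1) (by omega))
    let c : cartanTerm k (cliqueComplex Γ) (p + 1) := fun _ => 1
    have hker : cartanD k (cliqueComplex Γ) (p + 1) c = 0 := by
      ext1 J
      refine absurd ?_ (ih J.1 J.2.1 ?_) <;> rw [J.2.2]
      · omega
      · omega
    obtain ⟨b, hb⟩ := (hex c).1 hker
    have h1 := congrArg MvPolynomial.constantCoeff (congrFun hb ⟨σ, hσ, hp⟩)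
    have h2 : cartanDpre k (cliqueComplex Γ) (p + 1) b ⟨σ, hσ, hp⟩ =
        koszulTotal (fun i => LinearMap.mulLeft (polyRing k n) (MvPolynomial.X i))
          (extendFaces b) σ := koszulD_apply _ p b ⟨σ, hσ, hp⟩
    rw [h2, koszulTotal] at h1
    simp [c] at h1

end Cartan

/-! ### Restriction of scalars and the comparison theorem -/

/-- A semilinear variant of `Subquotient.nonempty_equiv`. -/
theorem Subquotient.nonempty_equiv_semilinear {R S : Type*} [Ring R] [Ring S] (σ : S →+* R)
    {M X Y : Type*} [AddCommGroup M] [Module R M] [Module S M] [AddCommGroup X] [Module R X]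
    [AddCommGroup Y] [Module S Y] (hM : ∀ (s : S) (x : M), s • x = σ s • x)
    {U' U : Submodule R X} {V' V : Submodule S Y} (e : M ≃ₗ[R] Subquotient U' U)
    (f : Y ≃+ X) (hf : ∀ (s : S) y, f (s • y) = σ s • f y)
    (hV : ∀ y, y ∈ V ↔ f y ∈ U) (hV' : ∀ y, y ∈ V' ↔ f y ∈ U') :
    Nonempty (M ≃ₗ[S] Subquotient V' V) := by
  let a : V →ₗ[S] Subquotient V' V := V'.mkQ.submoduleMap V
  let c : U →ₗ[R] Subquotient U' U := U'.mkQ.submoduleMap U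
  have ha : Function.Surjective a := LinearMap.submoduleMap_surjective _ _
  have hc : Function.Surjective c := LinearMap.submoduleMap_surjective _ _
  let b : V →ₗ[S] M :=
    { toFun := fun y => e.symm (c ⟨f y, (hV y).1 y.2⟩)
      map_add' := fun y z => by
        rw [← map_add, ← map_add]
        exact congrArg (fun u => e.symm (c u)) (Subtype.ext (map_add f y.1 z.1))
      map_smul' := fun s y => by
        rw [RingHom.id_apply, hM, ← map_smul, ← map_smul]
        exact congrArg (fun u => e.symm (c u)) (Subtype.ext (hf s y.1)) }
  have hb : Function.Surjective b := fun x => by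
    obtain ⟨u, hu⟩ := hc (e x)
    refine ⟨⟨f.symm u, (hV _).2 (by simp)⟩, ?_⟩
    change e.symm (c ⟨f (f.symm u), _⟩) = x
    simp [hu]
  have hab : LinearMap.ker b = LinearMap.ker a := by
    ext y
    rw [LinearMap.mem_ker, LinearMap.mem_ker]
    change e.symm (c ⟨f y, (hV y).1 y.2⟩) = 0 ↔ _
    rw [LinearEquiv.map_eq_zero_iff, Subtype.ext_iff, Subtype.ext_iff]
    change Submodule.Quotient.mk (f y.1) = _ ↔ Submodule.Quotient.mk y.1 = _
    erw [Submodule.Quotient.mk_eq_zero, Submodule.Quotient.mk_eq_zero, hV' y.1]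
  exact ⟨(b.quotKerEquivOfSurjective hb).symm.trans
    ((Submodule.quotEquivOfEq _ _ hab).trans (a.quotKerEquivOfSurjective ha))⟩

/-- A semilinear isomorphism of coefficients commutes with the Koszul differentials. -/
theorem koszulMulD_semilinear {R S X Y : Type*} [CommRing R] [CommRing S] (σ : S →+* R)
    [AddCommGroup X] [Module R X] [AddCommGroup Y] [Module S Y] (f : Y ≃+ X)
    (hf : ∀ (s : S) y, f (s • y) = σ s • f y) {n : ℕ} (K : Set (Finset (Fin n)))
    (t : Fin n → S) (p : ℕ) (c : {I : Finset (Fin n) // I ∈ K ∧ I.card = p} → Y) :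
    koszulMulD K (fun i => σ (t i)) X p (AddEquiv.piCongrRight (fun _ => f) c) =
      AddEquiv.piCongrRight (fun _ => f) (koszulMulD K t Y p c) := by
  ext J
  have : extendFaces (AddEquiv.piCongrRight (fun _ => f) c) = fun I => f (extendFaces c I) := by
    ext I
    unfold extendFaces
    split_ifs <;> simp
  simp [koszulD_apply, koszulTotal, this, hf]

theorem koszulMulDpre_semilinear {R S X Y : Type*} [CommRing R] [CommRing S] (σ : S →+* R)
    [AddCommGroup X] [Module R X] [AddCommGroup Y] [Module S Y] (f : Y ≃+ X)
    (hf : ∀ (s : S) y, f (s • y) = σ s • f y) {n : ℕ} (K : Set (Finset (Fin n)))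
    (t : Fin n → S) (p : ℕ) (c : {I : Finset (Fin n) // I ∈ K ∧ I.card = p - 1} → Y) :
    koszulMulDpre K (fun i => σ (t i)) X p (AddEquiv.piCongrRight (fun _ => f) c) =
      AddEquiv.piCongrRight (fun _ => f) (koszulMulDpre K t Y p c) := by
  cases p with
  | zero => exact (map_zero (AddEquiv.piCongrRight fun _ => f)).symm
  | succ p => exact koszulMulD_semilinear σ f hf K t p c

theorem nonempty_equiv_koszul_semilinear {R S X Y M : Type*} [CommRing R] [CommRing S]
    (σ : S →+* R) [AddCommGroup X] [Module R X] [AddCommGroup Y] [Module S Y] (f : Y ≃+ X)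
    (hf : ∀ (s : S) y, f (s • y) = σ s • f y) [AddCommGroup M] [Module R M] [Module S M]
    (hM : ∀ (s : S) (x : M), s • x = σ s • x) {n : ℕ} (K : Set (Finset (Fin n)))
    (t : Fin n → S) (p : ℕ)
    (e : M ≃ₗ[R] Subquotient (LinearMap.range (koszulMulDpre K (fun i => σ (t i)) X p))
      (LinearMap.ker (koszulMulD K (fun i => σ (t i)) X p))) :
    Nonempty (M ≃ₗ[S] Subquotient (LinearMap.range (koszulMulDpre K t Y p))
      (LinearMap.ker (koszulMulD K t Y p))) := by
  refine Subquotient.nonempty_equiv_semilinear σ hM e (AddEquiv.piCongrRight fun _ => f)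
    (fun s y => funext fun I => hf s (y I)) (fun y => ?_) fun y => ?_
  · rw [LinearMap.mem_ker, LinearMap.mem_ker, koszulMulD_semilinear σ f hf,
      AddEquiv.map_eq_zero_iff]
  · refine Iff.trans (exists_congr fun x => ?_)
      (AddEquiv.piCongrRight fun _ => f).surjective.exists.symm
    rw [koszulMulDpre_semilinear σ f hf, EmbeddingLike.apply_eq_iff_eq]

section Comparison

variable (k : Type) [Field k] {m n : ℕ} (f : Fin n → Fin m)

theorem phiS_X (i : Fin n) :
    phiS k f (MvPolynomial.X i) = AddMonoidAlgebra.single (Pi.single (f i) 1) 1 - 1 := by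
  simp [phiS]

theorem nonempty_groupCohomologyS_equiv_koszul (Γ : SimpleGraph (Fin n))
    (φ : RAAG Γ →* Multiplicative (Fin m → ℤ))
    (hφ : ∀ i, φ (PresentedGroup.of i) = Multiplicative.ofAdd (Pi.single (f i) 1)) (q : ℕ) :
    Nonempty (groupCohomologyS k φ f q ≃ₗ[polyRing k n]
      Subquotient (LinearMap.range (koszulMulDpre (cliqueComplex Γ)
          (MvPolynomial.X : Fin n → polyRing k n) (laurentAsSModule k f) q))
        (LinearMap.ker (koszulMulD (cliqueComplex Γ)
          (MvPolynomial.X : Fin n → polyRing k n) (laurentAsSModule k f) q))) := by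
  obtain ⟨e⟩ := nonempty_groupCohomologyLaurent_equiv_koszul k Γ φ
    (fun i => LinearMap.lsmul (LaurentRing k m) (LaurentRing k m)
      (phiS k f (MvPolynomial.X i)))
    (fun i r => by
      rw [hφ, LinearMap.lsmul_apply, phiS_X, smul_eq_mul, sub_mul, one_mul]; rfl) q
  let : Module (LaurentRing k m) (groupCohomologyS k φ f q) :=
    inferInstanceAs (Module _ (groupCohomologyLaurent k φ q))
  exact nonempty_equiv_koszul_semilinear (phiS k f) (Y := laurentAsSModule k f)
    (AddEquiv.refl (LaurentRing k m)) (fun s y => rfl) (fun s x => rfl) _ _ q e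

end Comparison

/-- The class map from top-dimensional Cartan cochains to cohomology. -/
theorem exists_cartan_class_map (k : Type) [Field k] {n : ℕ} (K : Set (Finset (Fin n))) {d : ℕ}
    (hK : ∀ σ ∈ K, σ.card ≤ d + 1) :
    ∃ r : cartanTerm k K (d + 1) →ₗ[polyRing k n] cartanCohomology k K (d + 1),
      Function.Surjective r ∧ Function.Exact (cartanD k K d) r := by
  have hker : ∀ c, c ∈ LinearMap.ker (cartanD k K (d + 1)) := fun c => by
    rw [LinearMap.mem_ker]
    ext1 J
    exact absurd (hK J.1 J.2.1) (by rw [J.2.2]; omega)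
  let r : cartanTerm k K (d + 1) →ₗ[polyRing k n] cartanCohomology k K (d + 1) :=
    (LinearMap.range (cartanDpre k K (d + 1))).mkQ.codRestrict (Submodule.map _ _)
      fun c => ⟨c, hker c, rfl⟩
  refine ⟨r, ?_, fun c => ?_⟩
  · rintro ⟨_, c, _, rfl⟩
    exact ⟨c, rfl⟩
  · refine Subtype.ext_iff.trans ?_
    exact Submodule.Quotient.mk_eq_zero _

/-- Let `K` be the clique complex of `Γ`, suppose the
Cartan complex of `K` has cohomology concentrated in degree `d + 1` (i.e.
`K` is Cohen–Macaulay of dimension `d`), and let `F_K` be that cohomology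
module.  Then for every `q` there is an isomorphism of `S`-modules
`H^q(G_Γ; k[ℤᵐ]) ≅ Tor^S_{d+1-q}(F_K, k[ℤᵐ])`; in particular for `q > d+1`
(where the `Tor` index would be negative) the cohomology vanishes. -/
theorem groupCohomology_iso_tor_of_cartan_concentrated {m : ℕ} {n : ℕ}
    (Γ : SimpleGraph (Fin n)) (d : ℕ)
    (hvanish : ∀ p : ℕ, p ≠ d + 1 →
      Subsingleton (cartanCohomology k (cliqueComplex Γ) p))
    (f : Fin n → Fin m) (hf : Function.Surjective f)
    (φ : RAAG Γ →* Multiplicative (Fin m → ℤ))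
    (hφ : ∀ i : Fin n, φ (PresentedGroup.of i) =
      Multiplicative.ofAdd (Pi.single (f i) 1)) :
    (∀ q : ℕ, q ≤ d + 1 →
      Nonempty
        (groupCohomologyS k φ f q ≃ₗ[polyRing k n]
          ↥(((Tor (ModuleCat (polyRing k n)) (d + 1 - q)).obj
              (ModuleCat.of (polyRing k n)
                (cartanCohomology k (cliqueComplex Γ) (d + 1)))).obj
            (laurentAsSModule k f)))) ∧
    (∀ q : ℕ, d + 1 < q → Subsingleton (groupCohomologyS k φ f q)) := by
  obtain ⟨r, hr, er⟩ := exists_cartan_class_map k (cliqueComplex Γ)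
    (card_le_of_cartan_concentrated k Γ hvanish)
  have hcard := card_le_of_cartan_concentrated k Γ hvanish
  constructor
  · intro q hq
    obtain ⟨e⟩ := nonempty_groupCohomologyS_equiv_koszul k f Γ φ hφ q
    obtain hq | rfl := hq.lt_or_eq
    · obtain ⟨e'⟩ := nonempty_koszul_equiv_tor (cliqueComplex Γ) MvPolynomial.X
        (ModuleCat.of (polyRing k n) (cartanCohomology k (cliqueComplex Γ) (d + 1)))
        (laurentAsSModule k f) r hr er (fun p hp => by
          rw [← cartanDpre_eq_koszulMulDpre]
          exact cartan_exact_of_subsingleton k Γ (hvanish p (by omega))) (Nat.lt_succ_iff.1 hq)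
      exact ⟨e.trans e'⟩
    · obtain ⟨e'⟩ := nonempty_koszul_top_equiv_tor (cliqueComplex Γ) MvPolynomial.X
        (ModuleCat.of (polyRing k n) (cartanCohomology k (cliqueComplex Γ) (d + 1)))
        (laurentAsSModule k f) r hr er
      have htop : LinearMap.ker (koszulMulD (cliqueComplex Γ)
          (MvPolynomial.X : Fin n → polyRing k n) (laurentAsSModule k f) (d + 1)) = ⊤ := by
        refine LinearMap.ker_eq_top.2 (LinearMap.ext fun c => funext fun J => ?_)
        exact absurd (hcard J.1 J.2.1) (by rw [J.2.2]; omega)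
      rw [htop] at e
      rw [Nat.sub_self]
      exact ⟨e.trans e'⟩
  · intro q hq
    obtain ⟨e⟩ := nonempty_groupCohomologyS_equiv_koszul k f Γ φ hφ q
    refine e.toEquiv.subsingleton_congr.2 ⟨?_⟩
    rintro ⟨_, x, -, rfl⟩ ⟨_, y, -, rfl⟩
    obtain rfl : x = y := funext fun J => absurd (hcard J.1 J.2.1) (by rw [J.2.2]; omega)
    rfl
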